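/- arXiv:1109.5908 — 11 statements merged into one kernel-verified Lean document; each statement's English description precedes it below -/
import Mathlib

section
/- For n ≥ 2, the number τ(P_n) of minimum dominating sets of the path P_n equals: 1 if n ≡ 0 (mod 3); n + (1/2)·⌊n/3⌋·(⌊n/3⌋ − 1) if n ≡ 1 (mod 3); and 2 + ⌊n/3⌋ if n ≡ 2 (mod 3). -/
open SimpleGraph Finset
open scoped Classical

/-- `D` is a dominating set of `G`: every vertex not in `D` is adjacent to a vertex in `D`. -/
def isDomSet {V : Type*} (G : SimpleGraph V) (D : Finset V) : Prop :=
  ∀ v : V, v ∉ D → ∃ u ∈ D, G.Adj u v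

/-- The domination number `γ(G)`: minimum cardinality of a dominating set of `G`. -/
noncomputable def domNum {V : Type*} [Fintype V] (G : SimpleGraph V) : ℕ :=
  sInf {n | ∃ D : Finset V, isDomSet G D ∧ D.card = n}

/-- The collection of minimum dominating sets (`γ(G)`-sets) of `G`. -/
noncomputable def gammaSets {V : Type*} [Fintype V] (G : SimpleGraph V) : Finset (Finset V) :=
  Finset.univ.filter (fun D => isDomSet G D ∧ D.card = domNum G)

/-- `τ(G)`: the total number of `γ(G)`-sets. -/
noncomputable def tau {V : Type*} [Fintype V] (G : SimpleGraph V) : ℕ :=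
  (gammaSets G).card

/-- The domination value `DV_G(v)`: the number of `γ(G)`-sets containing `v`. -/
noncomputable def DV {V : Type*} [Fintype V] (G : SimpleGraph V) (v : V) : ℕ :=
  ((gammaSets G).filter (fun D => v ∈ D)).card

/-- Each `i < m` lies in `D` or is next to an element of `D` on the number line. -/
def Covers (m : ℕ) (D : Finset ℕ) : Prop :=
  ∀ i < m, i ∈ D ∨ i + 1 ∈ D ∨ ∃ j ∈ D, j + 1 = i

/-- The number of `k`-subsets of `{0, …, n - 1}` satisfying `P`. -/
noncomputable def countSubsets (n k : ℕ) (P : Finset ℕ → Prop) : ℕ :=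
  #{D ∈ powersetCard k (range n) | P D}

/-- The number of `k`-subsets dominating the path on `{0, …, n - 1}`. -/
noncomputable def domCount (n k : ℕ) : ℕ := countSubsets n k (Covers n)

/-- The number of `k`-subsets dominating the path on `{0, …, n - 1}` together with the
extra vertex `n`. -/
noncomputable def domCountAux (n k : ℕ) : ℕ := countSubsets n k fun D => Covers n (insert n D)

lemma countSubsets_congr {n k : ℕ} {P Q : Finset ℕ → Prop}
    (h : ∀ D ⊆ range n, (P D ↔ Q D)) : countSubsets n k P = countSubsets n k Q := by
  unfold countSubsets
  congr 1
  exact filter_congr fun D hD => h D (mem_powersetCard.1 hD).1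

lemma countSubsets_zero (n : ℕ) (P : Finset ℕ → Prop) :
    countSubsets n 0 P = if P ∅ then 1 else 0 := by
  simp only [countSubsets, powersetCard_zero, filter_singleton]
  split_ifs <;> rfl

lemma countSubsets_false (n k : ℕ) : countSubsets n k (fun _ => False) = 0 := by
  simp [countSubsets]

lemma countSubsets_succ_succ (n k : ℕ) (P : Finset ℕ → Prop) :
    countSubsets (n + 1) (k + 1) P =
      countSubsets n (k + 1) P + countSubsets n k fun D => P (insert n D) := by
  unfold countSubsets
  rw [range_add_one, powersetCard_succ_insert notMem_range_self, filter_union,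
    card_union_of_disjoint, filter_image, card_image_of_injOn]
  · intro D hD E hE h
    simp only [coe_filter, mem_powersetCard, Set.mem_ofPred_eq] at hD hE
    have hn : ∀ {F : Finset ℕ}, F ⊆ range n → n ∉ F := fun hF h => notMem_range_self (hF h)
    rw [← erase_insert (hn hD.1.1), ← erase_insert (hn hE.1.1)]
    exact congrArg (·.erase n) h
  · rw [Finset.disjoint_left]
    intro D hD hD'
    simp only [mem_filter, mem_powersetCard, mem_image] at hD hD'
    obtain ⟨⟨E, -, rfl⟩, -⟩ := hD'
    exact notMem_range_self (hD.1.1 (mem_insert_self n E))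

lemma Covers.mono {m m' : ℕ} (h : m ≤ m') {D : Finset ℕ} (hD : Covers m' D) : Covers m D :=
  fun i hi => hD i (hi.trans_le h)

lemma covers_succ {m : ℕ} {D : Finset ℕ} :
    Covers (m + 1) D ↔ Covers m D ∧ (m ∈ D ∨ m + 1 ∈ D ∨ ∃ j ∈ D, j + 1 = m) := by
  refine ⟨fun h => ⟨h.mono m.le_succ, h m m.lt_succ_self⟩, fun ⟨h, h'⟩ i hi => ?_⟩
  rcases Nat.lt_succ_iff_lt_or_eq.1 hi with hi | rfl
  exacts [h i hi, h']

lemma covers_insert_of_lt {m x : ℕ} (h : m < x) {D : Finset ℕ} :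
    Covers m (insert x D) ↔ Covers m D := by
  refine forall₂_congr fun i hi => ?_
  simp only [mem_insert, exists_eq_or_imp]
  have h1 : i ≠ x := by omega
  have h2 : i + 1 ≠ x := by omega
  have h3 : x + 1 ≠ i := by omega
  simp [h1, h2, h3]

lemma notMem_of_subset_range {n m : ℕ} {D : Finset ℕ} (hD : D ⊆ range n) (h : n ≤ m) : m ∉ D :=
  fun hm => absurd (mem_range.1 (hD hm)) (by omega)

lemma domCountAux_succ_succ (n k : ℕ) :
    domCountAux (n + 1) (k + 1) = domCountAux n k + domCount n (k + 1) := by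
  unfold domCountAux domCount
  rw [countSubsets_succ_succ, add_comm]
  congr 1 <;> refine countSubsets_congr fun D _ => ?_
  · rw [covers_succ, covers_insert_of_lt n.lt_succ_self]
    simp
  · rw [covers_succ, covers_insert_of_lt n.lt_succ_self]
    simp

lemma domCount_succ_succ (n k : ℕ) :
    domCount (n + 1) (k + 1) = domCountAux n k + countSubsets n (k + 1) (Covers (n + 1)) := by
  unfold domCountAux domCount
  rw [countSubsets_succ_succ, add_comm]
  congr 1
  refine countSubsets_congr fun D _ => ?_
  rw [covers_succ]
  simp

lemma countSubsets_covers_succ (n k : ℕ) :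
    countSubsets (n + 1) (k + 1) (Covers (n + 2)) = domCountAux n k := by
  have hfalse : countSubsets n (k + 1) (Covers (n + 2)) = 0 := by
    rw [← countSubsets_false n (k + 1)]
    refine countSubsets_congr fun D hD => iff_false_intro fun h => ?_
    rcases h (n + 1) (by omega) with h | h | ⟨j, hj, h⟩
    · exact notMem_of_subset_range hD (by omega) h
    · exact notMem_of_subset_range hD (by omega) h
    · exact notMem_of_subset_range hD (by omega) hj
  rw [countSubsets_succ_succ, hfalse, zero_add, domCountAux]
  refine countSubsets_congr fun D _ => ?_
  rw [covers_succ, covers_succ]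
  simp

lemma domCount_add_two_succ (n k : ℕ) :
    domCount (n + 2) (k + 1) = domCountAux (n + 1) k + domCountAux n k := by
  rw [domCount_succ_succ, countSubsets_covers_succ]

lemma domCountAux_add_three_succ (n k : ℕ) :
    domCountAux (n + 3) (k + 1) =
      domCountAux (n + 2) k + domCountAux (n + 1) k + domCountAux n k := by
  rw [domCountAux_succ_succ, domCount_add_two_succ, add_assoc]

lemma domCount_zero_right {n : ℕ} (hn : 0 < n) : domCount n 0 = 0 := by
  rw [domCount, countSubsets_zero, if_neg]
  intro h
  simpa using h 0 hn

lemma domCountAux_zero_zero : domCountAux 0 0 = 1 := by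
  simp [domCountAux, countSubsets_zero, Covers]

lemma domCountAux_one_zero : domCountAux 1 0 = 1 := by
  simp [domCountAux, countSubsets_zero, Covers]

lemma domCountAux_two_one : domCountAux 2 1 = 2 := by
  have h : countSubsets 0 1 (Covers 1) = 0 := by simp [countSubsets]
  rw [domCountAux_succ_succ, domCount_succ_succ, h, domCountAux_zero_zero, domCountAux_one_zero]

lemma domCountAux_eq_zero {n k : ℕ} (h : 3 * k + 1 < n) : domCountAux n k = 0 := by
  induction k generalizing n with
  | zero =>
    rw [domCountAux, countSubsets_zero, if_neg]
    intro hc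
    have := hc 0 (by omega)
    simp only [insert_empty_eq, mem_singleton, exists_eq_left] at this
    omega
  | succ k ih =>
    obtain ⟨m, rfl⟩ : ∃ m, n = m + 3 := ⟨n - 3, by omega⟩
    rw [domCountAux_add_three_succ, ih (by omega), ih (by omega), ih (by omega)]

lemma domCountAux_three_mul_add_one (k : ℕ) : domCountAux (3 * k + 1) k = 1 := by
  induction k with
  | zero => exact domCountAux_one_zero
  | succ k ih =>
    rw [show 3 * (k + 1) + 1 = 3 * k + 1 + 3 by ring, domCountAux_add_three_succ, ih,
      domCountAux_eq_zero (by omega), domCountAux_eq_zero (by omega)]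

lemma domCountAux_three_mul (k : ℕ) : domCountAux (3 * k) k = k + 1 := by
  induction k with
  | zero => exact domCountAux_zero_zero
  | succ k ih =>
    rw [show 3 * (k + 1) = 3 * k + 3 by ring, domCountAux_add_three_succ, ih,
      domCountAux_three_mul_add_one, domCountAux_eq_zero (by omega)]
    ring

lemma two_mul_domCountAux (k : ℕ) :
    2 * domCountAux (3 * k + 2) (k + 1) = (k + 1) * (k + 4) := by
  induction k with
  | zero => simp [domCountAux_two_one]
  | succ k ih =>
    have h1 := domCountAux_three_mul_add_one (k + 1)
    have h2 := domCountAux_three_mul (k + 1)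
    rw [show 3 * (k + 1) + 1 = 3 * k + 2 + 2 by ring] at h1
    rw [show 3 * (k + 1) = 3 * k + 2 + 1 by ring] at h2
    rw [show 3 * (k + 1) + 2 = 3 * k + 2 + 3 by ring, domCountAux_add_three_succ, h1, h2,
      mul_add, ih]
    ring

lemma domCount_eq_zero {n k : ℕ} (h : 3 * k < n) : domCount n k = 0 := by
  cases k with
  | zero => exact domCount_zero_right (by omega)
  | succ k =>
    obtain ⟨m, rfl⟩ : ∃ m, n = m + 2 := ⟨n - 2, by omega⟩
    rw [domCount_add_two_succ, domCountAux_eq_zero (by omega), domCountAux_eq_zero (by omega)]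

lemma domCount_three_mul (k : ℕ) : domCount (3 * (k + 1)) (k + 1) = 1 := by
  rw [show 3 * (k + 1) = 3 * k + 1 + 2 by ring, domCount_add_two_succ,
    domCountAux_three_mul_add_one, domCountAux_eq_zero (by omega)]

lemma domCount_three_mul_add_two (k : ℕ) : domCount (3 * k + 2) (k + 1) = k + 2 := by
  rw [domCount_add_two_succ, domCountAux_three_mul_add_one, domCountAux_three_mul]
  ring

lemma two_mul_domCount_three_mul_add_one (k : ℕ) :
    2 * domCount (3 * (k + 1) + 1) (k + 2) = 2 * (3 * (k + 1) + 1) + (k + 1) * k := by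
  have h := domCountAux_three_mul (k + 1)
  rw [show 3 * (k + 1) = 3 * k + 2 + 1 by ring] at h
  rw [show 3 * (k + 1) + 1 = 3 * k + 2 + 2 by ring, domCount_add_two_succ, h, mul_add,
    two_mul_domCountAux]
  ring

lemma isDomSet_pathGraph_iff {n : ℕ} (D : Finset (Fin n)) :
    isDomSet (pathGraph n) D ↔ Covers n (D.map Fin.valEmbedding) := by
  simp only [isDomSet, Covers, pathGraph_adj, mem_map, Fin.valEmbedding_apply]
  constructor
  · intro h i hi
    by_cases hD : (⟨i, hi⟩ : Fin n) ∈ D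
    · exact Or.inl ⟨_, hD, rfl⟩
    · obtain ⟨u, hu, h | h⟩ := h _ hD
      · exact Or.inr (Or.inr ⟨u, ⟨u, hu, rfl⟩, h⟩)
      · exact Or.inr (Or.inl ⟨u, hu, h.symm⟩)
  · intro h v hv
    rcases h v v.2 with ⟨u, hu, h⟩ | ⟨u, hu, h⟩ | ⟨j, ⟨u, hu, rfl⟩, h⟩
    · exact absurd (Fin.ext h ▸ hu) hv
    · exact ⟨u, hu, Or.inr h.symm⟩
    · exact ⟨u, hu, Or.inl h⟩

lemma card_isDomSet_pathGraph (n k : ℕ) :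
    #{D : Finset (Fin n) | isDomSet (pathGraph n) D ∧ #D = k} = domCount n k := by
  rw [domCount, countSubsets]
  refine card_bij (fun D _ => D.map Fin.valEmbedding) (fun D hD => ?_)
    (fun D _ E _ h => map_injective _ h) fun E hE => ?_
  · simp only [mem_filter, mem_univ, true_and] at hD
    rw [mem_filter, mem_powersetCard, card_map, ← isDomSet_pathGraph_iff]
    refine ⟨⟨fun i hi => ?_, hD.2⟩, hD.1⟩
    obtain ⟨u, -, rfl⟩ := mem_map.1 hi
    exact mem_range.2 u.2
  · rw [mem_filter, mem_powersetCard] at hE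
    have hlt : ∀ i ∈ E, i < n := fun i hi => mem_range.1 (hE.1.1 hi)
    have hmap : (E.attachFin hlt).map Fin.valEmbedding = E := map_valEmbedding_attachFin hlt
    refine ⟨E.attachFin hlt, ?_, hmap⟩
    rw [mem_filter, isDomSet_pathGraph_iff, hmap, card_attachFin]
    exact ⟨mem_univ _, hE.2, hE.1.2⟩

lemma tau_eq_of_forall_lt {V : Type*} [Fintype V] {G : SimpleGraph V} {k : ℕ}
    (hk : #{D : Finset V | isDomSet G D ∧ #D = k} ≠ 0)
    (hlt : ∀ j < k, #{D : Finset V | isDomSet G D ∧ #D = j} = 0) :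
    tau G = #{D : Finset V | isDomSet G D ∧ #D = k} := by
  have hdom : domNum G = k := by
    obtain ⟨D, hD⟩ := card_ne_zero.1 hk
    have hmem : k ∈ {n | ∃ D : Finset V, isDomSet G D ∧ #D = n} := ⟨D, (mem_filter.1 hD).2⟩
    refine le_antisymm (Nat.sInf_le hmem) (le_csInf ⟨k, hmem⟩ ?_)
    rintro j ⟨E, hE⟩
    by_contra! hj
    exact notMem_empty E (card_eq_zero.1 (hlt j hj) ▸ mem_filter.2 ⟨mem_univ E, hE⟩)
  rw [tau, gammaSets, hdom]

lemma tau_pathGraph_eq_domCount {n k : ℕ} (hk : domCount n k ≠ 0) (hn : 3 * k < n + 3) :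
    tau (pathGraph n) = domCount n k := by
  rw [← card_isDomSet_pathGraph] at hk ⊢
  refine tau_eq_of_forall_lt hk fun j hj => ?_
  rw [card_isDomSet_pathGraph]
  exact domCount_eq_zero (by omega)

theorem tau_pathGraph (n : ℕ) (hn : 2 ≤ n) :
    tau (pathGraph n) =
      if n % 3 = 0 then 1
      else if n % 3 = 1 then n + (n / 3) * (n / 3 - 1) / 2
      else 2 + n / 3 := by
  obtain ⟨q, hq⟩ : ∃ q, n / 3 = q := ⟨_, rfl⟩
  rw [hq]
  split_ifs with h0 h1
  · obtain ⟨k, rfl⟩ : ∃ k, n = 3 * (k + 1) := ⟨q - 1, by omega⟩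
    have h := domCount_three_mul k
    rw [tau_pathGraph_eq_domCount (by rw [h]; exact one_ne_zero) (by omega), h]
  · obtain ⟨k, rfl⟩ : ∃ k, n = 3 * (k + 1) + 1 := ⟨q - 1, by omega⟩
    obtain rfl : q = k + 1 := by omega
    have h := two_mul_domCount_three_mul_add_one k
    rw [tau_pathGraph_eq_domCount (k := k + 2) (by omega) (by omega), Nat.add_sub_cancel]
    omega
  · obtain rfl : n = 3 * q + 2 := by omega
    have h := domCount_three_mul_add_two q
    rw [tau_pathGraph_eq_domCount (by rw [h]; omega) (by omega), h, add_comm]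
end

section
/- Let k ≥ 1 and let the vertices of the path P_{3k} be labeled 1 through 3k consecutively. Then for a vertex v of P_{3k}: DV(v) = 0 if v ≡ 0 or 1 (mod 3), and DV(v) = 1 if v ≡ 2 (mod 3). -/
open SimpleGraph Finset
open scoped Classical

/-- The labels of a dominating set of `pathGraph n`, as natural numbers, dominate `range n`. -/
theorem isDomSet_pathGraph_mem {n : ℕ} {D : Finset (Fin n)} (hD : isDomSet (pathGraph n) D)
    {a : ℕ} (ha : a < n) :
    a ∈ D.map Fin.valEmbedding ∨ a + 1 ∈ D.map Fin.valEmbedding ∨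
      ∃ b ∈ D.map Fin.valEmbedding, b + 1 = a := by
  by_cases h : (⟨a, ha⟩ : Fin n) ∈ D
  · exact Or.inl (mem_map.2 ⟨_, h, rfl⟩)
  · obtain ⟨u, hu, hadj⟩ := hD _ h
    rcases pathGraph_adj.1 hadj with e | e
    · exact Or.inr (Or.inr ⟨u, mem_map.2 ⟨u, hu, rfl⟩, e⟩)
    · exact Or.inr (Or.inl (mem_map.2 ⟨u, hu, e.symm⟩))

/-- A dominating set of `P_{3k}` meets each block `{3i, 3i + 1, 3i + 2}`. -/
theorem range_subset_image_div_three {k : ℕ} {D : Finset (Fin (3 * k))}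
    (hD : isDomSet (pathGraph (3 * k)) D) :
    range k ⊆ (D.map Fin.valEmbedding).image (· / 3) := by
  intro i hi
  rw [mem_range] at hi
  rw [mem_image]
  rcases isDomSet_pathGraph_mem hD (a := 3 * i + 1) (by omega) with h | h | ⟨b, h, hb⟩
  · exact ⟨_, h, by omega⟩
  · exact ⟨_, h, by omega⟩
  · exact ⟨b, h, by omega⟩

theorem le_card_of_isDomSet_pathGraph {k : ℕ} {D : Finset (Fin (3 * k))}
    (hD : isDomSet (pathGraph (3 * k)) D) : k ≤ D.card := by
  simpa using (card_le_card (range_subset_image_div_three hD)).trans card_image_le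

/-- A dominating set of `P_{3k}` with `k` elements consists of centers of the blocks. -/
theorem mod_three_eq_one_of_isDomSet {k : ℕ} {D : Finset (Fin (3 * k))}
    (hD : isDomSet (pathGraph (3 * k)) D) (hcard : D.card = k) {u : Fin (3 * k)} (hu : u ∈ D) :
    u.val % 3 = 1 := by
  set S := D.map Fin.valEmbedding with hS
  have hlt : ∀ a ∈ S, a < 3 * k := by
    intro a ha
    obtain ⟨w, -, rfl⟩ := mem_map.1 ha
    exact w.isLt
  have hinj : Set.InjOn (· / 3) (S : Set ℕ) := by
    apply card_image_iff.1
    apply le_antisymm card_image_le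
    simpa [hS, hcard] using card_le_card (range_subset_image_div_three hD)
  have huniq : ∀ a ∈ S, ∀ b ∈ S, a / 3 = b / 3 → a = b := fun a ha b hb h => hinj ha hb h
  have hzero : ∀ j i, i + j = k → 3 * i ∉ S := by
    intro j
    induction j with
    | zero => intro i hi h; have := hlt _ h; omega
    | succ j ih =>
      intro i hi h
      rcases isDomSet_pathGraph_mem hD (a := 3 * i + 2) (by omega) with h' | h' | ⟨b, h', hb⟩
      · have := huniq _ h _ h' (by omega); omega
      · exact ih (i + 1) (by omega) h'
      · have := huniq _ h _ h' (by omega); omega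
  have htwo : ∀ i, 3 * i + 2 ∉ S := by
    intro i
    induction i with
    | zero =>
      intro h
      have := hlt _ h
      rcases isDomSet_pathGraph_mem hD (a := 0) (by omega) with h' | h' | ⟨b, h', hb⟩
      · have := huniq _ h _ h' (by omega); omega
      · have := huniq _ h _ h' (by omega); omega
      · omega
    | succ i ih =>
      intro h
      have := hlt _ h
      rcases isDomSet_pathGraph_mem hD (a := 3 * i + 3) (by omega) with h' | h' | ⟨b, h', hb⟩
      · have := huniq _ h _ h' (by omega); omega
      · have := huniq _ h _ h' (by omega); omega
      · obtain rfl : b = 3 * i + 2 := by omega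
        exact ih h'
  have hmem : u.val ∈ S := mem_map.2 ⟨u, hu, rfl⟩
  have hult := u.isLt
  by_contra hne
  obtain h | h : u.val % 3 = 0 ∨ u.val % 3 = 2 := by omega
  · apply hzero (k - u.val / 3) (u.val / 3) (by omega)
    rwa [show 3 * (u.val / 3) = u.val by omega]
  · apply htwo (u.val / 3)
    rwa [show 3 * (u.val / 3) + 2 = u.val by omega]

/-- The vertices of `P_{3k}` with labels congruent to `1` modulo `3`, counting from `0`. -/
noncomputable def pathCenters (k : ℕ) : Finset (Fin (3 * k)) :=
  univ.image fun i : Fin k => ⟨3 * i.val + 1, by omega⟩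

theorem mem_pathCenters {k : ℕ} {u : Fin (3 * k)} : u ∈ pathCenters k ↔ u.val % 3 = 1 := by
  simp only [pathCenters, mem_image, mem_univ, true_and, Fin.ext_iff]
  constructor
  · rintro ⟨i, hi⟩
    omega
  · intro h
    exact ⟨⟨u.val / 3, by omega⟩, by simp only; omega⟩

theorem card_pathCenters (k : ℕ) : (pathCenters k).card = k := by
  rw [pathCenters, card_image_of_injective, card_fin]
  intro i j h
  simp only [Fin.mk.injEq] at h
  omega

theorem isDomSet_pathCenters (k : ℕ) : isDomSet (pathGraph (3 * k)) (pathCenters k) := by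
  intro u hu
  rw [mem_pathCenters] at hu
  have hlt := u.isLt
  refine ⟨⟨3 * (u.val / 3) + 1, by omega⟩, mem_pathCenters.2 (by simp only; omega), ?_⟩
  rw [pathGraph_adj]
  simp only
  omega

theorem domNum_pathGraph_three_mul (k : ℕ) : domNum (pathGraph (3 * k)) = k := by
  apply le_antisymm
  · exact Nat.sInf_le ⟨_, isDomSet_pathCenters k, card_pathCenters k⟩
  · refine le_csInf ⟨_, pathCenters k, isDomSet_pathCenters k, rfl⟩ ?_
    rintro _ ⟨D, hD, rfl⟩
    exact le_card_of_isDomSet_pathGraph hD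

theorem gammaSets_pathGraph_three_mul (k : ℕ) :
    gammaSets (pathGraph (3 * k)) = {pathCenters k} := by
  ext D
  simp only [gammaSets, mem_filter, mem_univ, true_and, mem_singleton,
    domNum_pathGraph_three_mul]
  constructor
  · rintro ⟨hD, hcard⟩
    refine eq_of_subset_of_card_le (fun u hu => ?_) (by rw [card_pathCenters, hcard])
    exact mem_pathCenters.2 (mod_three_eq_one_of_isDomSet hD hcard hu)
  · rintro rfl
    exact ⟨isDomSet_pathCenters k, card_pathCenters k⟩

theorem DV_pathGraph_three_mul (k : ℕ) (hk : 1 ≤ k) (v : ℕ) (hv1 : 1 ≤ v) (hv2 : v ≤ 3 * k) :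
    DV (pathGraph (3 * k)) ⟨v - 1, by omega⟩ =
      if v % 3 = 2 then 1 else 0 := by
  have hmod : (v - 1) % 3 = 1 ↔ v % 3 = 2 := by omega
  rw [DV, gammaSets_pathGraph_three_mul]
  split_ifs with h <;> simp [filter_singleton, mem_pathCenters, hmod, h]
end

section
/- Let k ≥ 1 and let the vertices of the path P_{3k+1} be labeled 1 through 3k+1 consecutively. Write a vertex v as v = 3q + r with integers q ≥ 0 and 0 ≤ r < 3. Then DV(v) = (1/2)·q·(q+3) if v ≡ 0 (mod 3); DV(v) = (q+1)·(k−q+1) if v ≡ 1 (mod 3); and DV(v) = (1/2)·(k−q)·(k−q+3) if v ≡ 2 (mod 3). -/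
open SimpleGraph Finset
open scoped Classical

/-- The set of vertices of the path on `3 * k + 1` vertices that meets the block
`{3 * i - 1, 3 * i, 3 * i + 1}` in its last vertex if `i < a`, in its middle vertex if
`a ≤ i ≤ b`, and in its first vertex if `b < i`. -/
noncomputable def thresholdSet (k a b : ℕ) : Finset (Fin (3 * k + 1)) :=
  univ.filter fun u => u.1 % 3 = 1 ∧ u.1 / 3 < a ∨ u.1 % 3 = 0 ∧ a ≤ u.1 / 3 ∧ u.1 / 3 ≤ b ∨
    u.1 % 3 = 2 ∧ b ≤ u.1 / 3

/-- The parameters `(a, b)` for which `thresholdSet k a b` is a minimum dominating set. -/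
def thresholdPairs (k : ℕ) : Finset (ℕ × ℕ) :=
  (range (k + 1) ×ˢ range (k + 1)).filter fun p => p.1 ≤ p.2 + 1

theorem mem_thresholdSet {k a b : ℕ} {u : Fin (3 * k + 1)} :
    u ∈ thresholdSet k a b ↔ u.1 % 3 = 1 ∧ u.1 / 3 < a ∨
      u.1 % 3 = 0 ∧ a ≤ u.1 / 3 ∧ u.1 / 3 ≤ b ∨ u.1 % 3 = 2 ∧ b ≤ u.1 / 3 := by
  simp [thresholdSet]

theorem mem_thresholdPairs {k : ℕ} {p : ℕ × ℕ} :
    p ∈ thresholdPairs k ↔ p.1 ≤ k ∧ p.2 ≤ k ∧ p.1 ≤ p.2 + 1 := by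
  simp only [thresholdPairs, mem_filter, mem_product, mem_range]
  omega

theorem isDomSet_pathGraph_iff_s4 {n : ℕ} {D : Finset (Fin n)} :
    isDomSet (pathGraph n) D ↔
      ∀ v : Fin n, ∃ u ∈ D, u.1 ≤ v.1 + 1 ∧ v.1 ≤ u.1 + 1 := by
  constructor
  · intro h v
    by_cases hv : v ∈ D
    · exact ⟨v, hv, by omega, by omega⟩
    · obtain ⟨u, hu, huv⟩ := h v hv
      rw [pathGraph_adj] at huv
      exact ⟨u, hu, by omega, by omega⟩
  · intro h v hv
    obtain ⟨u, hu, h1, h2⟩ := h v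
    refine ⟨u, hu, ?_⟩
    rw [pathGraph_adj]
    have : u.1 ≠ v.1 := fun e => hv (Fin.ext e ▸ hu)
    omega

theorem surjOn_block_of_isDomSet {k : ℕ} {D : Finset (Fin (3 * k + 1))}
    (hD : isDomSet (pathGraph (3 * k + 1)) D) :
    Set.SurjOn (fun u : Fin (3 * k + 1) => (u.1 + 1) / 3) D (range (k + 1)) := by
  rw [isDomSet_pathGraph_iff_s4] at hD
  intro i hi
  have hi' : i < k + 1 := by simpa using hi
  obtain ⟨u, hu, h1, h2⟩ := hD ⟨3 * i, by omega⟩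
  refine ⟨u, hu, ?_⟩
  dsimp only at h1 h2 ⊢
  omega

theorem le_card_of_isDomSet {k : ℕ} {D : Finset (Fin (3 * k + 1))}
    (hD : isDomSet (pathGraph (3 * k + 1)) D) : k + 1 ≤ D.card := by
  simpa using card_le_card_of_surjOn _ (surjOn_block_of_isDomSet hD)

theorem injOn_block_of_isDomSet {k : ℕ} {D : Finset (Fin (3 * k + 1))}
    (hD : isDomSet (pathGraph (3 * k + 1)) D) (hc : D.card = k + 1) :
    Set.InjOn (fun u : Fin (3 * k + 1) => (u.1 + 1) / 3) D := by
  refine injOn_of_surjOn_of_card_le (t := range (k + 1)) _ ?_ (surjOn_block_of_isDomSet hD)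
    (by simp [hc])
  intro u _
  have := u.2
  simp only [coe_range, Set.mem_Iio]
  omega

theorem isDomSet_thresholdSet {k : ℕ} (hk : 1 ≤ k) {p : ℕ × ℕ} (hp : p ∈ thresholdPairs k) :
    isDomSet (pathGraph (3 * k + 1)) (thresholdSet k p.1 p.2) := by
  rw [isDomSet_pathGraph_iff_s4]
  rw [mem_thresholdPairs] at hp
  obtain ⟨a, b⟩ := p
  dsimp only at hp ⊢
  intro v
  have hv := v.2
  by_cases h0 : v ∈ thresholdSet k a b
  · exact ⟨v, h0, by omega, by omega⟩
  by_cases h1 : ∃ h : v.1 + 1 < 3 * k + 1, (⟨v.1 + 1, h⟩ : Fin _) ∈ thresholdSet k a b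
  · obtain ⟨h, h1⟩ := h1
    exact ⟨_, h1, by simp, by simp; omega⟩
  refine ⟨⟨v.1 - 1, by omega⟩, ?_, by simp; omega, by simp; omega⟩
  simp only [mem_thresholdSet, not_exists] at h0 h1 ⊢
  by_cases h : v.1 + 1 < 3 * k + 1
  · have := h1 h
    omega
  · omega

theorem card_thresholdSet {k : ℕ} (hk : 1 ≤ k) {p : ℕ × ℕ} (hp : p ∈ thresholdPairs k) :
    (thresholdSet k p.1 p.2).card = k + 1 := by
  refine le_antisymm ?_ (le_card_of_isDomSet (isDomSet_thresholdSet hk hp))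
  rw [mem_thresholdPairs] at hp
  obtain ⟨a, b⟩ := p
  dsimp only at hp ⊢
  conv_rhs => rw [← card_range (k + 1)]
  refine card_le_card_of_injOn (fun u => (u.1 + 1) / 3) ?_ ?_
  · intro u _
    have := u.2
    simp only [coe_range, Set.mem_Iio]
    omega
  · intro u hu w hw h
    rw [mem_coe, mem_thresholdSet] at hu hw
    dsimp only at h
    ext
    omega

theorem domNum_pathGraph {k : ℕ} (hk : 1 ≤ k) : domNum (pathGraph (3 * k + 1)) = k + 1 := by
  have hp : ((0, 0) : ℕ × ℕ) ∈ thresholdPairs k := by simp [mem_thresholdPairs]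
  refine le_antisymm (Nat.sInf_le ⟨_, isDomSet_thresholdSet hk hp, card_thresholdSet hk hp⟩) ?_
  refine le_csInf ⟨_, _, isDomSet_thresholdSet hk hp, card_thresholdSet hk hp⟩ ?_
  rintro n ⟨D, hD, rfl⟩
  exact le_card_of_isDomSet hD

theorem exists_le_forall_iff_lt {Q : ℕ → Prop} {k : ℕ} (hQ : ∀ i, Q (i + 1) → Q i)
    (hk : ¬ Q k) : ∃ a ≤ k, ∀ i, Q i ↔ i < a := by
  have hmono : ∀ i j, i ≤ j → Q j → Q i := by
    intro i j hij
    induction hij with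
    | refl => exact id
    | step _ ih => exact fun h => ih (hQ _ h)
  have hex : ∃ i, ¬ Q i := ⟨k, hk⟩
  refine ⟨Nat.find hex, Nat.find_le hk, fun i => ⟨fun h => ?_, fun h => ?_⟩⟩
  · by_contra hi
    exact Nat.find_spec hex (hmono _ _ (not_lt.1 hi) h)
  · exact not_not.1 (Nat.find_min hex h)

theorem exists_eq_thresholdSet {k : ℕ} {D : Finset (Fin (3 * k + 1))}
    (hD : isDomSet (pathGraph (3 * k + 1)) D) (hc : D.card = k + 1) :
    ∃ p ∈ thresholdPairs k, thresholdSet k p.1 p.2 = D := by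
  have hinj := injOn_block_of_isDomSet hD hc
  rw [isDomSet_pathGraph_iff_s4] at hD
  let P : ℕ → Prop := fun m => ∃ h : m < 3 * k + 1, (⟨m, h⟩ : Fin _) ∈ D
  have hlt : ∀ m, P m → m < 3 * k + 1 := fun m h => h.1
  have huniq : ∀ m n, P m → P n → (m + 1) / 3 = (n + 1) / 3 → m = n := by
    rintro m n ⟨hm, hm'⟩ ⟨hn, hn'⟩ h
    simpa using hinj hm' hn' h
  have hdom : ∀ m < 3 * k + 1, ∃ n, P n ∧ n ≤ m + 1 ∧ m ≤ n + 1 := by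
    intro m hm
    obtain ⟨u, hu, h⟩ := hD ⟨m, hm⟩
    exact ⟨u.1, ⟨u.2, hu⟩, h⟩
  have hmem : ∀ u : Fin (3 * k + 1), u ∈ D ↔ P u.1 := fun u =>
    ⟨fun h => ⟨u.2, h⟩, fun h => h.2⟩
  clear_value P
  have hlast : ∀ i, P (3 * (i + 1) + 1) → P (3 * i + 1) := by
    intro i hi
    have := hlt _ hi
    obtain ⟨n, hn, h1, h2⟩ := hdom (3 * i + 2) (by omega)
    have h3 := huniq _ _ hi hn
    have : n = 3 * i + 1 := by omega
    exact this ▸ hn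
  have hfirst : ∀ i, i + 1 < k → P (3 * i + 2) → P (3 * (i + 1) + 2) := by
    intro i hik hi
    obtain ⟨n, hn, h1, h2⟩ := hdom (3 * i + 4) (by omega)
    have h3 := huniq _ _ hi hn
    have : n = 3 * (i + 1) + 2 := by omega
    exact this ▸ hn
  obtain ⟨a, hak, ha⟩ := exists_le_forall_iff_lt (Q := fun i => P (3 * i + 1)) (k := k) hlast
    (fun h => by have := hlt _ h; omega)
  obtain ⟨b, hbk, hb⟩ := exists_le_forall_iff_lt (Q := fun i => i < k ∧ ¬ P (3 * i + 2)) (k := k)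
    (fun i ⟨h, h'⟩ => ⟨by omega, fun hi => h' (hfirst i h hi)⟩) (by simp)
  have hbP : ∀ i, P (3 * i + 2) ↔ i < k ∧ b ≤ i := by
    intro i
    have h1 := hb i
    have h2 := hlt (3 * i + 2)
    by_cases h : P (3 * i + 2)
    · have := h2 h
      simp only [h, not_true, and_false, false_iff] at h1
      simp only [h, true_iff]
      omega
    · simp only [h, not_false_iff, and_true] at h1
      simp only [h, false_iff]
      omega
  refine ⟨(a, b), mem_thresholdPairs.2 ⟨hak, hbk, ?_⟩, ?_⟩
  · dsimp only
    by_contra! hab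
    have h1 := (ha (b + 1)).2 (by omega)
    have h2 := (hbP b).2 (by omega)
    have := huniq _ _ h1 h2
    omega
  · ext u
    have hu := u.2
    rw [mem_thresholdSet, hmem]
    dsimp only
    generalize u.1 = m at hu
    obtain ⟨i, rfl | rfl | rfl⟩ : ∃ i, m = 3 * i ∨ m = 3 * i + 1 ∨ m = 3 * i + 2 :=
      ⟨m / 3, by omega⟩
    · have hmid : P (3 * i) ↔ a ≤ i ∧ i ≤ b := by
        constructor
        · intro h
          constructor
          · by_contra! hi
            have := huniq _ _ h ((ha i).2 hi)
            omega
          · by_contra! hi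
            have := huniq _ _ h ((hbP (i - 1)).2 (by omega))
            omega
        · rintro ⟨h1, h2⟩
          obtain ⟨n, hn, h3, h4⟩ := hdom (3 * i) hu
          by_cases h5 : n = 3 * i
          · exact h5 ▸ hn
          by_cases h6 : n = 3 * i + 1
          · have := (ha i).1 (h6 ▸ hn)
            omega
          · have h7 : n = 3 * (i - 1) + 2 := by omega
            have := (hbP (i - 1)).1 (h7 ▸ hn)
            omega
      rw [hmid]
      omega
    · rw [ha]
      omega
    · rw [hbP]
      omega

theorem thresholdSet_injOn (k : ℕ) :
    Set.InjOn (fun p : ℕ × ℕ => thresholdSet k p.1 p.2) (thresholdPairs k) := by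
  rintro ⟨a, b⟩ hp ⟨c, d⟩ hq h
  rw [mem_coe, mem_thresholdPairs] at hp hq
  dsimp only at hp hq h
  have key := fun m (hm : m < 3 * k + 1) => Finset.ext_iff.1 h ⟨m, hm⟩
  simp only [mem_thresholdSet] at key
  have hac : a = c := by
    by_contra hne
    have := key (3 * min a c + 1) (by omega)
    omega
  have hbd : b = d := by
    by_contra hne
    have := key (3 * min b d + 2) (by omega)
    omega
  rw [hac, hbd]

theorem gammaSets_pathGraph {k : ℕ} (hk : 1 ≤ k) :
    gammaSets (pathGraph (3 * k + 1)) =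
      (thresholdPairs k).image fun p => thresholdSet k p.1 p.2 := by
  ext D
  simp only [gammaSets, mem_filter, mem_univ, true_and, mem_image, domNum_pathGraph hk]
  constructor
  · rintro ⟨hD, hc⟩
    exact exists_eq_thresholdSet hD hc
  · rintro ⟨p, hp, rfl⟩
    exact ⟨isDomSet_thresholdSet hk hp, card_thresholdSet hk hp⟩

theorem DV_pathGraph_eq_card {k : ℕ} (hk : 1 ≤ k) (u : Fin (3 * k + 1)) :
    DV (pathGraph (3 * k + 1)) u =
      ((thresholdPairs k).filter fun p => u ∈ thresholdSet k p.1 p.2).card := by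
  have hinj := (thresholdSet_injOn k).mono
    (coe_subset.2 (filter_subset (fun p => u ∈ thresholdSet k p.1 p.2) (thresholdPairs k)))
  rw [DV, gammaSets_pathGraph hk, ← card_image_of_injOn hinj]
  congr 1
  ext D
  simp only [mem_filter, mem_image]
  constructor
  · rintro ⟨⟨p, hp, rfl⟩, hu⟩
    exact ⟨p, ⟨hp, hu⟩, rfl⟩
  · rintro ⟨p, ⟨hp, hu⟩, rfl⟩
    exact ⟨⟨p, hp, rfl⟩, hu⟩

theorem sum_range_add_two (m : ℕ) : ∑ i ∈ range m, (i + 2) = m * (m + 3) / 2 := by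
  have h : (∑ i ∈ range m, (i + 2)) * 2 = m * (m + 3) := by
    induction m with
    | zero => simp
    | succ m ih => rw [sum_range_succ, add_mul, ih]; ring
  omega

/-- The number of pairs `(i, j)` with `i < m` and `j < i + 2`. -/
theorem card_sigma_range_add_two (m : ℕ) :
    ((range m).sigma fun i => range (i + 2)).card = m * (m + 3) / 2 := by
  simp [card_sigma, sum_range_add_two]

theorem DV_pathGraph_three_mul_add_one (k : ℕ) (hk : 1 ≤ k) (v q r : ℕ)
    (hv1 : 1 ≤ v) (hv2 : v ≤ 3 * k + 1) (hqr : v = 3 * q + r) (hr : r < 3) :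
    DV (pathGraph (3 * k + 1)) ⟨v - 1, by omega⟩ =
      if r = 0 then q * (q + 3) / 2
      else if r = 1 then (q + 1) * (k - q + 1)
      else (k - q) * (k - q + 3) / 2 := by
  rw [DV_pathGraph_eq_card hk]
  split_ifs with h0 h1
  · rw [← card_sigma_range_add_two]
    refine card_nbij' (fun p => ⟨p.2, p.1⟩) (fun s => (s.2, s.1)) ?_ ?_
      (fun _ _ => rfl) (fun _ _ => rfl) <;>
    · intro x hx
      simp only [coe_filter, Set.mem_ofPred_eq, coe_sigma, Set.mem_sigma_iff, mem_coe,
        mem_thresholdPairs, mem_thresholdSet, mem_range] at hx ⊢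
      omega
  · have : (thresholdPairs k).filter (fun p => (⟨v - 1, by omega⟩ : Fin (3 * k + 1)) ∈
        thresholdSet k p.1 p.2) = range (q + 1) ×ˢ Icc q k := by
      ext p
      simp only [mem_filter, mem_thresholdPairs, mem_thresholdSet, mem_product, mem_range, mem_Icc]
      omega
    rw [this, card_product, card_range, Nat.card_Icc]
    congr 1
    omega
  · rw [← card_sigma_range_add_two]
    refine card_nbij' (fun p => ⟨k - p.1, k - p.2⟩) (fun s => (k - s.1, k - s.2)) ?_ ?_ ?_ ?_
    · intro x hx
      simp only [coe_filter, Set.mem_ofPred_eq, coe_sigma, Set.mem_sigma_iff, mem_coe,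
        mem_thresholdPairs, mem_thresholdSet, mem_range] at hx ⊢
      omega
    · intro x hx
      simp only [coe_filter, Set.mem_ofPred_eq, coe_sigma, Set.mem_sigma_iff, mem_coe,
        mem_thresholdPairs, mem_thresholdSet, mem_range] at hx ⊢
      omega
    · intro x hx
      simp only [mem_coe, mem_filter, mem_thresholdPairs] at hx
      ext <;> dsimp only <;> omega
    · rintro ⟨i, j⟩ hx
      simp only [mem_coe, mem_sigma, mem_range] at hx
      have hi : k - (k - i) = i := by omega
      have hj : k - (k - j) = j := by omega
      simp only [hi, hj]
end

section
/- For n ≥ 3, the number τ(C_n) of minimum dominating sets of the cycle C_n equals: 3 if n ≡ 0 (mod 3); n·(1 + (1/2)·⌊n/3⌋) if n ≡ 1 (mod 3); and n if n ≡ 2 (mod 3). -/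
open SimpleGraph Finset
open scoped Classical

/-- The `c`-element subsets `S` of `{0, …, N - 1}` such that every `i < N` lies in `[s, s + 3)` for
some `s ∈ S`; equivalently, the sequences of `c` gaps in `{1, 2, 3}` with sum `N`. -/
noncomputable def gapCovers (c N : ℕ) : Finset (Finset ℕ) :=
  ((range N).powersetCard c).filter (fun S => ∀ i < N, ∃ s ∈ S, s ≤ i ∧ i < s + 3)

theorem mem_gapCovers {c N : ℕ} {S : Finset ℕ} :
    S ∈ gapCovers c N ↔
      (∀ s ∈ S, s < N) ∧ S.card = c ∧ ∀ i < N, ∃ s ∈ S, s ≤ i ∧ i < s + 3 := by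
  simp [gapCovers, mem_powersetCard, subset_iff, and_assoc]

theorem card_gapCovers_zero (N : ℕ) : (gapCovers 0 N).card = if N = 0 then 1 else 0 := by
  split_ifs with h
  · subst h
    simp [gapCovers]
  · rw [card_eq_zero, eq_empty_iff_forall_notMem]
    intro S hS
    obtain ⟨-, h2, h3⟩ := mem_gapCovers.1 hS
    rw [card_eq_zero] at h2
    obtain ⟨s, hs, -⟩ := h3 0 (by omega)
    simp [h2] at hs

/-- Removing the largest element `m` of a gap cover of `N` leaves a gap cover of `m`. -/
theorem card_gapCovers_filter_max {c N m : ℕ} (hm : m < N) (hN : N ≤ m + 3) :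
    ((gapCovers (c + 1) N).filter (fun S => m ∈ S ∧ ∀ s ∈ S, s ≤ m)).card =
      (gapCovers c m).card := by
  refine card_bij' (fun S _ => S.erase m) (fun S _ => insert m S) ?_ ?_ ?_ ?_
  · intro S hS
    obtain ⟨hS, hmS, hmax⟩ := mem_filter.1 hS
    obtain ⟨-, h2, h3⟩ := mem_gapCovers.1 hS
    refine mem_gapCovers.2 ⟨fun s hs => ?_, by rw [card_erase_of_mem hmS, h2]; rfl, fun i hi => ?_⟩
    · have := hmax s (mem_of_mem_erase hs)
      have := ne_of_mem_erase hs
      omega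
    · obtain ⟨s, hs, h⟩ := h3 i (by omega)
      exact ⟨s, mem_erase.2 ⟨by omega, hs⟩, h⟩
  · intro S hS
    obtain ⟨h1, h2, h3⟩ := mem_gapCovers.1 hS
    have hmS : m ∉ S := fun h => lt_irrefl _ (h1 m h)
    refine mem_filter.2 ⟨mem_gapCovers.2 ⟨fun s hs => ?_, by rw [card_insert_of_notMem hmS, h2],
      fun i hi => ?_⟩, mem_insert_self _ _, fun s hs => ?_⟩
    · rcases mem_insert.1 hs with rfl | hs
      · exact hm
      · exact (h1 s hs).trans hm
    · by_cases him : i < m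
      · obtain ⟨s, hs, h⟩ := h3 i him
        exact ⟨s, mem_insert_of_mem hs, h⟩
      · exact ⟨m, mem_insert_self _ _, by omega, by omega⟩
    · rcases mem_insert.1 hs with rfl | hs
      · exact le_rfl
      · exact (h1 s hs).le
  · intro S hS
    exact insert_erase (mem_filter.1 hS).2.1
  · intro S hS
    exact erase_insert fun h => lt_irrefl _ ((mem_gapCovers.1 hS).1 m h)

theorem card_gapCovers_succ (c N : ℕ) :
    (gapCovers (c + 1) N).card =
      ∑ m ∈ (range N).filter (fun m => N ≤ m + 3), (gapCovers c m).card := by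
  have hunion : gapCovers (c + 1) N = ((range N).filter (fun m => N ≤ m + 3)).biUnion
      (fun m => (gapCovers (c + 1) N).filter (fun S => m ∈ S ∧ ∀ s ∈ S, s ≤ m)) := by
    ext S
    simp only [mem_biUnion, mem_filter, mem_range]
    refine ⟨fun hS => ?_, fun ⟨m, _, h, _⟩ => h⟩
    obtain ⟨h1, h2, h3⟩ := mem_gapCovers.1 hS
    have hne : S.Nonempty := card_pos.1 (by omega)
    have hmem := S.max'_mem hne
    have hlt := h1 _ hmem
    obtain ⟨s, hs, h⟩ := h3 (N - 1) (by omega)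
    have := S.le_max' s hs
    exact ⟨S.max' hne, ⟨hlt, by omega⟩, hS, hmem, fun s hs => S.le_max' s hs⟩
  rw [hunion, card_biUnion]
  · refine sum_congr rfl fun m hm => ?_
    obtain ⟨hm, hN⟩ := mem_filter.1 hm
    exact card_gapCovers_filter_max (mem_range.1 hm) hN
  · intro a _ b _ hab
    refine disjoint_left.2 fun S ha hb => hab ?_
    obtain ⟨-, ha, ha'⟩ := mem_filter.1 ha
    obtain ⟨-, hb, hb'⟩ := mem_filter.1 hb
    exact le_antisymm (hb' a ha) (ha' b hb)

theorem card_gapCovers_succ_add_three (c N : ℕ) :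
    (gapCovers (c + 1) (N + 3)).card =
      (gapCovers c N).card + (gapCovers c (N + 1)).card + (gapCovers c (N + 2)).card := by
  have : (range (N + 3)).filter (fun m => N + 3 ≤ m + 3) = {N, N + 1, N + 2} := by
    ext m
    simp only [mem_filter, mem_range, mem_insert, mem_singleton]
    omega
  rw [card_gapCovers_succ, this]
  simp [add_assoc]

theorem card_gapCovers_of_lt {c N : ℕ} (h : 3 * c < N) : (gapCovers c N).card = 0 := by
  induction c generalizing N with
  | zero => rw [card_gapCovers_zero, if_neg (by omega)]
  | succ c ih =>
    obtain ⟨N, rfl⟩ : ∃ M, N = M + 3 := ⟨N - 3, by omega⟩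
    rw [card_gapCovers_succ_add_three, ih (by omega), ih (by omega), ih (by omega)]

theorem card_gapCovers_three_mul (c : ℕ) : (gapCovers c (3 * c)).card = 1 := by
  induction c with
  | zero => simp [card_gapCovers_zero]
  | succ c ih =>
    rw [mul_add, mul_one, card_gapCovers_succ_add_three, ih, card_gapCovers_of_lt (by omega),
      card_gapCovers_of_lt (by omega)]

theorem card_gapCovers_three_mul_add_two (c : ℕ) :
    (gapCovers (c + 1) (3 * c + 2)).card = c + 1 := by
  induction c with
  | zero => simp [card_gapCovers_succ, card_gapCovers_zero]
  | succ c ih =>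
    rw [show 3 * (c + 1) + 2 = 3 * c + 2 + 3 by ring, card_gapCovers_succ_add_three, ih,
      show 3 * c + 2 + 1 = 3 * (c + 1) by ring, card_gapCovers_three_mul,
      card_gapCovers_of_lt (by omega)]

theorem card_gapCovers_three_mul_add_one (c : ℕ) :
    2 * (gapCovers (c + 1) (3 * c + 1)).card = (c + 1) * (c + 2) := by
  induction c with
  | zero => simp [card_gapCovers_succ, card_gapCovers_zero]
  | succ c ih =>
    rw [show 3 * (c + 1) + 1 = 3 * c + 1 + 3 by ring, card_gapCovers_succ_add_three, mul_add,
      mul_add, ih, show 3 * c + 1 + 1 = 3 * c + 2 by ring, card_gapCovers_three_mul_add_two,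
      show 3 * c + 1 + 2 = 3 * (c + 1) by ring, card_gapCovers_three_mul]
    ring

theorem cycleGraph_adj_val {m : ℕ} {u v : Fin (m + 3)} :
    (cycleGraph (m + 3)).Adj u v ↔ v.val = u.val + 1 ∨ u.val = v.val + 1 ∨
      (u.val = 0 ∧ v.val = m + 2) ∨ (v.val = 0 ∧ u.val = m + 2) := by
  have hu := u.isLt
  have hv := v.isLt
  rw [cycleGraph_adj', Fin.val_sub, Fin.val_sub]
  have key : ∀ a b : ℕ, a < m + 3 → b < m + 3 →
      ((m + 3 - b + a) % (m + 3) = 1 ↔ a = b + 1 ∨ (a = 0 ∧ b = m + 2)) := by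
    intro a b ha hb
    by_cases h : b ≤ a
    · rw [show m + 3 - b + a = a - b + (m + 3) by omega, Nat.add_mod_right,
        Nat.mod_eq_of_lt (by omega)]
      omega
    · rw [Nat.mod_eq_of_lt (by omega)]
      omega
  rw [key _ _ hu hv, key _ _ hv hu]
  tauto

theorem isDomSet_cycleGraph_iff {m : ℕ} {D : Finset (Fin (m + 3))} (h0 : 0 ∈ D) :
    isDomSet (cycleGraph (m + 3)) D ↔
      ∀ i < m + 3, ∃ s ∈ D.map Fin.valEmbedding, s ≤ i ∧ i < s + 3 := by
  simp only [mem_map, Fin.valEmbedding_apply, exists_exists_and_eq_and]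
  constructor
  · intro h i hi
    by_cases hi1 : i ≤ 1
    · exact ⟨0, h0, by simp, by simp; omega⟩
    · let v : Fin (m + 3) := ⟨i - 1, by omega⟩
      by_cases hv : v ∈ D
      · exact ⟨v, hv, by simp [v], by simp [v]; omega⟩
      · obtain ⟨u, hu, huv⟩ := h v hv
        have hv' : v.val = i - 1 := rfl
        have := cycleGraph_adj_val.1 huv
        exact ⟨u, hu, by omega, by omega⟩
  · intro h v hv
    have hlt := v.isLt
    by_cases hv2 : v.val = m + 2
    · exact ⟨0, h0, cycleGraph_adj_val.2 (by simp [hv2])⟩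
    · obtain ⟨u, hu, h1, h2⟩ := h (v.val + 1) (by omega)
      have hne : u.val ≠ v.val := fun h => hv (Fin.ext h ▸ hu)
      exact ⟨u, hu, cycleGraph_adj_val.2 (by omega)⟩

theorem card_isDomSet_zero_mem (m c : ℕ) :
    (univ.filter (fun D : Finset (Fin (m + 3)) =>
      (isDomSet (cycleGraph (m + 3)) D ∧ D.card = c) ∧ 0 ∈ D)).card =
      (gapCovers c (m + 3)).card := by
  refine card_bij (fun D _ => D.map Fin.valEmbedding) ?_ ?_ ?_
  · intro D hD
    obtain ⟨-, ⟨h1, h2⟩, h0⟩ := mem_filter.1 hD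
    refine mem_gapCovers.2 ⟨fun s hs => ?_, by rw [card_map, h2],
      (isDomSet_cycleGraph_iff h0).1 h1⟩
    obtain ⟨u, -, rfl⟩ := mem_map.1 hs
    exact u.isLt
  · intro D _ E _ h
    exact map_injective _ h
  · intro S hS
    obtain ⟨h1, h2, h3⟩ := mem_gapCovers.1 hS
    have hS' : (S.attachFin h1).map Fin.valEmbedding = S := map_valEmbedding_attachFin h1
    have h0 : 0 ∈ S.attachFin h1 := by
      obtain ⟨s, hs, h, -⟩ := h3 0 (by omega)
      obtain rfl : s = 0 := by omega
      simpa using hs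
    refine ⟨S.attachFin h1, mem_filter.2 ⟨mem_univ _, ⟨?_, ?_⟩, h0⟩, hS'⟩
    · rw [isDomSet_cycleGraph_iff h0, hS']
      exact h3
    · rw [card_attachFin, h2]

theorem isDomSet.map {V : Type*} {G : SimpleGraph V} {D : Finset V} (h : isDomSet G D)
    (φ : G ≃g G) : isDomSet G (D.map φ.toEquiv.toEmbedding) := by
  intro v hv
  have hv' : φ.symm v ∉ D := fun h => hv (mem_map.2 ⟨_, h, φ.apply_symm_apply v⟩)
  obtain ⟨u, hu, huv⟩ := h _ hv'
  refine ⟨φ u, mem_map_of_mem _ hu, ?_⟩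
  simpa using φ.map_adj_iff.2 huv

theorem DV_le_DV_apply {V : Type*} [Fintype V] {G : SimpleGraph V} (φ : G ≃g G) (v : V) :
    DV G v ≤ DV G (φ v) := by
  refine card_le_card_of_injOn (fun D => D.map φ.toEquiv.toEmbedding) ?_
    (Finset.map_injective _).injOn
  intro D hD
  obtain ⟨hD, hv⟩ := mem_filter.1 hD
  obtain ⟨-, h1, h2⟩ := mem_filter.1 hD
  refine mem_filter.2 ⟨mem_filter.2 ⟨mem_univ _, h1.map φ, by rw [card_map, h2]⟩, ?_⟩
  exact mem_map_of_mem _ hv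

theorem DV_apply {V : Type*} [Fintype V] {G : SimpleGraph V} (φ : G ≃g G) (v : V) :
    DV G (φ v) = DV G v := by
  refine le_antisymm ?_ (DV_le_DV_apply φ v)
  simpa using DV_le_DV_apply φ.symm (φ v)

theorem sum_DV {V : Type*} [Fintype V] (G : SimpleGraph V) :
    ∑ v, DV G v = tau G * domNum G := by
  have h := sum_card_bipartiteAbove_eq_sum_card_bipartiteBelow
    (s := (univ : Finset V)) (t := gammaSets G) (fun v D => v ∈ D)
  have h2 : ∀ D ∈ gammaSets G, (bipartiteBelow (fun v D => v ∈ D) univ D).card = domNum G := by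
    intro D hD
    rw [← (mem_filter.1 hD).2.2]
    congr 1
    ext v
    simp [bipartiteBelow]
  rw [sum_congr rfl h2, sum_const, smul_eq_mul] at h
  exact h

/-- Translation by `a` as an automorphism of the cycle graph. -/
def cycleGraphTranslate (m : ℕ) (a : Fin (m + 3)) : cycleGraph (m + 3) ≃g cycleGraph (m + 3) where
  toEquiv := Equiv.addRight a
  map_rel_iff' := by
    intro u v
    simp [cycleGraph_adj]

theorem DV_cycleGraph_s6 (m : ℕ) (v : Fin (m + 3)) :
    DV (cycleGraph (m + 3)) v =
      (gapCovers (domNum (cycleGraph (m + 3))) (m + 3)).card := by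
  have h := DV_apply (cycleGraphTranslate m v) 0
  rw [show cycleGraphTranslate m v 0 = v from zero_add v] at h
  rw [h, DV, gammaSets, filter_filter, ← card_isDomSet_zero_mem]
  congr

theorem le_three_mul_card_of_isDomSet_cycleGraph {m : ℕ} {D : Finset (Fin (m + 3))}
    (h : isDomSet (cycleGraph (m + 3)) D) : m + 3 ≤ 3 * D.card := by
  obtain ⟨a, ha⟩ : D.Nonempty := by
    rw [nonempty_iff_ne_empty]
    rintro rfl
    obtain ⟨u, hu, -⟩ := h 0 (notMem_empty _)
    exact notMem_empty _ hu
  by_contra hlt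
  have hcard := card_isDomSet_zero_mem m D.card
  rw [card_gapCovers_of_lt (by omega), card_eq_zero] at hcard
  refine eq_empty_iff_forall_notMem.1 hcard
    (D.map (cycleGraphTranslate m (-a)).toEquiv.toEmbedding)
    (mem_filter.2 ⟨mem_univ _, ⟨h.map _, card_map _⟩, mem_map.2 ⟨a, ha, ?_⟩⟩)
  exact add_neg_cancel a

theorem domNum_cycleGraph {m c : ℕ} (hc : 3 * c < m + 6) (h : (gapCovers c (m + 3)).card ≠ 0) :
    domNum (cycleGraph (m + 3)) = c := by
  rw [← card_isDomSet_zero_mem, card_ne_zero] at h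
  obtain ⟨D, hD⟩ := h
  obtain ⟨-, ⟨h1, h2⟩, -⟩ := mem_filter.1 hD
  have hmem : c ∈ {n | ∃ D : Finset (Fin (m + 3)), isDomSet (cycleGraph (m + 3)) D ∧
      D.card = n} := ⟨D, h1, h2⟩
  refine le_antisymm (Nat.sInf_le hmem) (le_csInf ⟨c, hmem⟩ ?_)
  rintro _ ⟨E, hE, rfl⟩
  have := le_three_mul_card_of_isDomSet_cycleGraph hE
  omega

theorem tau_cycleGraph_mul {n c : ℕ} (hn : 3 ≤ n) (hc : 3 * c < n + 3)
    (h : (gapCovers c n).card ≠ 0) :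
    tau (cycleGraph n) * c = n * (gapCovers c n).card := by
  obtain ⟨m, rfl⟩ : ∃ m, n = m + 3 := ⟨n - 3, by omega⟩
  have hdom := domNum_cycleGraph hc h
  have hsum := sum_DV (cycleGraph (m + 3))
  simp only [DV_cycleGraph_s6, hdom, sum_const, card_univ, Fintype.card_fin, smul_eq_mul] at hsum
  exact hsum.symm

theorem tau_cycleGraph (n : ℕ) (hn : 3 ≤ n) :
    tau (cycleGraph n) =
      if n % 3 = 0 then 3
      else if n % 3 = 1 then n * (n / 3 + 2) / 2
      else n := by
  split_ifs with h0 h1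
  · obtain ⟨k, rfl⟩ : ∃ k, n = 3 * k := ⟨n / 3, by omega⟩
    have hk := card_gapCovers_three_mul k
    have h := tau_cycleGraph_mul (c := k) hn (by omega) (by omega)
    rw [hk, mul_one] at h
    exact Nat.eq_of_mul_eq_mul_right (by omega) h
  · obtain ⟨k, rfl⟩ : ∃ k, n = 3 * k + 1 := ⟨n / 3, by omega⟩
    have hk := card_gapCovers_three_mul_add_one k
    have h := tau_cycleGraph_mul (c := k + 1) hn (by omega) (by
      intro h
      simp [h] at hk)
    rw [show (3 * k + 1) / 3 = k by omega]
    refine (Nat.div_eq_of_eq_mul_left two_pos ?_).symm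
    refine Nat.eq_of_mul_eq_mul_right (Nat.succ_pos k) ?_
    calc (3 * k + 1) * (k + 2) * (k + 1)
        = (3 * k + 1) * (2 * (gapCovers (k + 1) (3 * k + 1)).card) := by rw [hk]; ring
      _ = 2 * (tau (cycleGraph (3 * k + 1)) * (k + 1)) := by rw [h]; ring
      _ = tau (cycleGraph (3 * k + 1)) * 2 * (k + 1) := by ring
  · obtain ⟨k, rfl⟩ : ∃ k, n = 3 * k + 2 := ⟨n / 3, by omega⟩
    have hk := card_gapCovers_three_mul_add_two k
    have h := tau_cycleGraph_mul (c := k + 1) hn (by omega) (by omega)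
    rw [hk] at h
    exact Nat.eq_of_mul_eq_mul_right (Nat.succ_pos k) h
end

section
/- For n ≥ 3 and any vertex v of the cycle C_n: DV(v) = 1 if n ≡ 0 (mod 3); DV(v) = (1/2)·⌈n/3⌉·(1 + ⌈n/3⌉) if n ≡ 1 (mod 3); and DV(v) = ⌈n/3⌉ if n ≡ 2 (mod 3). -/
open SimpleGraph Finset
open scoped Classical

/-- The sets `E ⊆ {0, …, m - 1}` of `k` elements, containing `0` if `m > 0`, whose consecutive
elements, followed by `m`, differ by at most `3`. -/
noncomputable def gapSets (m k : ℕ) : Finset (Finset ℕ) :=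
  (range m).powerset.filter fun E => E.card = k ∧ (0 < m → 0 ∈ E) ∧
    ∀ i, i + 2 < m → i ∈ E ∨ i + 1 ∈ E ∨ i + 2 ∈ E

theorem mem_gapSets {m k : ℕ} {E : Finset ℕ} :
    E ∈ gapSets m k ↔ (∀ i ∈ E, i < m) ∧ E.card = k ∧ (0 < m → 0 ∈ E) ∧
      ∀ i, i + 2 < m → i ∈ E ∨ i + 1 ∈ E ∨ i + 2 ∈ E := by
  simp [gapSets, subset_iff]

theorem gapSets_zero_right {m : ℕ} (hm : 0 < m) : gapSets m 0 = ∅ := by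
  ext E
  simp only [mem_gapSets, card_eq_zero, notMem_empty, iff_false]
  rintro ⟨-, rfl, h, -⟩
  simpa using h hm

theorem card_gapSets_zero_zero : (gapSets 0 0).card = 1 := by
  rw [card_eq_one]
  refine ⟨∅, ?_⟩
  ext E
  simp only [mem_gapSets, card_eq_zero, mem_singleton]
  constructor
  · exact fun h => h.2.1
  · rintro rfl
    simp

theorem gapSets_one_right {m : ℕ} (h1 : 1 ≤ m) (h3 : m ≤ 3) : gapSets m 1 = {{0}} := by
  ext E
  simp only [mem_gapSets, card_eq_one, mem_singleton]
  constructor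
  · rintro ⟨-, ⟨a, rfl⟩, h, -⟩
    rw [mem_singleton.1 (h h1)]
  · rintro rfl
    refine ⟨by simpa using Nat.pos_of_ne_zero (by omega), ⟨0, rfl⟩, by simp, fun i hi => ?_⟩
    left
    simp
    omega

theorem insert_mem_gapSets {m k j : ℕ} {E : Finset ℕ} (hj : 1 ≤ j) (hj' : j ≤ 3)
    (h : E ∈ gapSets m k) : insert m E ∈ gapSets (m + j) (k + 1) := by
  rw [mem_gapSets] at h ⊢
  obtain ⟨hlt, hc, h0, hw⟩ := h
  have hm : m ∉ E := fun h => (hlt m h).false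
  refine ⟨?_, by rw [card_insert_of_notMem hm, hc], ?_, ?_⟩
  · intro i hi
    rcases mem_insert.1 hi with rfl | hi
    · omega
    · have := hlt i hi
      omega
  · intro _
    rcases Nat.eq_zero_or_pos m with rfl | hp
    · simp
    · exact mem_insert_of_mem (h0 hp)
  · intro i hi
    simp only [mem_insert]
    by_cases hi' : i + 2 < m
    · have := hw i hi'
      tauto
    · omega

theorem erase_mem_gapSets {m k j : ℕ} {E : Finset ℕ} (h : E ∈ gapSets (m + j) (k + 1))
    (hm : m ∈ E) (hmax : ∀ i ∈ E, i ≤ m) : E.erase m ∈ gapSets m k := by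
  rw [mem_gapSets] at h ⊢
  obtain ⟨hlt, hc, h0, hw⟩ := h
  refine ⟨?_, by rw [card_erase_of_mem hm, hc]; rfl, ?_, ?_⟩
  · intro i hi
    have := hmax i (mem_of_mem_erase hi)
    have := ne_of_mem_erase hi
    omega
  · intro hp
    exact mem_erase.2 ⟨by omega, h0 (by omega)⟩
  · intro i hi
    have := hw i (by omega)
    simp only [mem_erase]
    rcases this with h | h | h
    · exact Or.inl ⟨by omega, h⟩
    · exact Or.inr (Or.inl ⟨by omega, h⟩)
    · exact Or.inr (Or.inr ⟨by omega, h⟩)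

theorem card_filter_gapSets {m k j : ℕ} (hj : 1 ≤ j) (hj' : j ≤ 3) :
    ((gapSets (m + j) (k + 1)).filter fun E => m ∈ E ∧ ∀ i ∈ E, i ≤ m).card =
      (gapSets m k).card := by
  refine card_nbij' (fun E => E.erase m) (fun E => insert m E) ?_ ?_ ?_ ?_
  · intro E hE
    simp only [mem_coe, mem_filter] at hE
    exact erase_mem_gapSets hE.1 hE.2.1 hE.2.2
  · intro E hE
    have hE' := mem_gapSets.1 hE
    simp only [mem_coe, mem_filter]
    refine ⟨insert_mem_gapSets hj hj' hE, mem_insert_self _ _, fun i hi => ?_⟩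
    rcases mem_insert.1 hi with rfl | hi
    · exact le_rfl
    · exact (hE'.1 i hi).le
  · intro E hE
    simp only [mem_coe, mem_filter] at hE
    exact insert_erase hE.2.1
  · intro E hE
    exact erase_insert fun h => ((mem_gapSets.1 hE).1 m h).false

theorem card_gapSets_add_three (m k : ℕ) :
    (gapSets (m + 3) (k + 1)).card =
      (gapSets (m + 2) k).card + (gapSets (m + 1) k).card + (gapSets m k).card := by
  rw [← card_filter_gapSets (m := m + 2) (j := 1) le_rfl (by omega),
    ← card_filter_gapSets (m := m + 1) (j := 2) (by omega) (by omega),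
    ← card_filter_gapSets (m := m) (j := 3) (by omega) le_rfl,
    show m + 2 + 1 = m + 3 by omega, show m + 1 + 2 = m + 3 by omega,
    ← card_union_of_disjoint, ← card_union_of_disjoint]
  · congr 1
    ext E
    simp only [mem_union, mem_filter]
    constructor
    · intro h
      obtain ⟨hlt, -, -, hw⟩ := mem_gapSets.1 h
      have hw := hw m (by omega)
      have h2 : m + 2 ∉ E → ∀ i ∈ E, i ≤ m + 1 := fun h2 i hi => by
        have := hlt i hi
        have : i ≠ m + 2 := fun h => h2 (h ▸ hi)
        omega
      have h1 : m + 2 ∉ E → m + 1 ∉ E → ∀ i ∈ E, i ≤ m := fun h2' h1 i hi => by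
        have := h2 h2' i hi
        have : i ≠ m + 1 := fun h => h1 (h ▸ hi)
        omega
      have h3 : ∀ i ∈ E, i ≤ m + 2 := fun i hi => by
        have := hlt i hi
        omega
      tauto
    · tauto
  · rw [Finset.disjoint_left]
    intro E hE hE'
    simp only [mem_union, mem_filter] at hE hE'
    rcases hE with hE | hE
    · have := hE'.2.2 _ hE.2.1
      omega
    · have := hE'.2.2 _ hE.2.1
      omega
  · rw [Finset.disjoint_left]
    intro E hE hE'
    simp only [mem_filter] at hE hE'
    have := hE'.2.2 _ hE.2.1
    omega

theorem card_gapSets_of_lt {m k : ℕ} (h : 3 * k < m) : (gapSets m k).card = 0 := by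
  induction k generalizing m with
  | zero => rw [gapSets_zero_right (by omega), card_empty]
  | succ k ih =>
    obtain ⟨m, rfl⟩ := Nat.exists_eq_add_of_le' (show 3 ≤ m by omega)
    rw [card_gapSets_add_three, ih (by omega), ih (by omega), ih (by omega)]

theorem card_gapSets_three_mul (k : ℕ) : (gapSets (3 * k) k).card = 1 := by
  induction k with
  | zero => exact card_gapSets_zero_zero
  | succ k ih =>
    rw [Nat.mul_succ, card_gapSets_add_three, ih, card_gapSets_of_lt (by omega),
      card_gapSets_of_lt (by omega)]

theorem card_gapSets_three_mul_add_two (k : ℕ) :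
    (gapSets (3 * k + 2) (k + 1)).card = k + 1 := by
  induction k with
  | zero => rw [gapSets_one_right (by omega) (by omega), card_singleton]
  | succ k ih =>
    rw [show 3 * (k + 1) + 2 = 3 * k + 2 + 3 by ring, card_gapSets_add_three, ih,
      card_gapSets_of_lt (by omega), show 3 * k + 2 + 1 = 3 * (k + 1) by ring,
      card_gapSets_three_mul]
    ring

theorem two_mul_card_gapSets_three_mul_add_one (k : ℕ) :
    2 * (gapSets (3 * k + 1) (k + 1)).card = (k + 1) * (k + 2) := by
  induction k with
  | zero => rw [gapSets_one_right (by omega) (by omega), card_singleton]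
  | succ k ih =>
    rw [show 3 * (k + 1) + 1 = 3 * k + 1 + 3 by ring, card_gapSets_add_three, mul_add, ih,
      show 3 * k + 1 + 2 = 3 * (k + 1) by ring, card_gapSets_three_mul,
      show 3 * k + 1 + 1 = 3 * k + 2 by ring, card_gapSets_three_mul_add_two]
    ring

theorem card_gapSets_div (n : ℕ) (hn : 1 ≤ n) :
    (gapSets n ((n + 2) / 3)).card =
      if n % 3 = 0 then 1
      else if n % 3 = 1 then ((n + 2) / 3) * (1 + (n + 2) / 3) / 2
      else (n + 2) / 3 := by
  have hd := Nat.div_add_mod n 3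
  have hlt := Nat.mod_lt n (show 0 < 3 by omega)
  generalize n / 3 = q at hd
  generalize hr : n % 3 = r at hd hlt
  interval_cases r
  · obtain rfl : n = 3 * q := by omega
    rw [show (3 * q + 2) / 3 = q by omega, card_gapSets_three_mul, if_pos rfl]
  · obtain rfl : n = 3 * q + 1 := by omega
    have := two_mul_card_gapSets_three_mul_add_one q
    rw [show (3 * q + 1 + 2) / 3 = q + 1 by omega, if_neg one_ne_zero, if_pos rfl,
      show 1 + (q + 1) = q + 2 by ring, ← this]
    omega
  · obtain rfl : n = 3 * q + 2 := by omega
    rw [show (3 * q + 2 + 2) / 3 = q + 1 by omega, card_gapSets_three_mul_add_two]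
    simp

theorem card_gapSets_div_pos {n : ℕ} (hn : 1 ≤ n) : 0 < (gapSets n ((n + 2) / 3)).card := by
  rw [card_gapSets_div n hn]
  split_ifs
  · exact one_pos
  · have : 1 ≤ (n + 2) / 3 := by omega
    have : 1 * 2 ≤ (n + 2) / 3 * (1 + (n + 2) / 3) := Nat.mul_le_mul this (by omega)
    omega
  · omega

/-- The positions of the elements of `D` when the cycle is read off starting from `v`. -/
noncomputable def positions {n : ℕ} (v : Fin n) (D : Finset (Fin n)) : Finset ℕ :=
  D.image fun u => (u - v).val

theorem val_sub_eq_ite {n : ℕ} (a b : Fin n) :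
    (a - b).val = if b.val ≤ a.val then a.val - b.val else n + a.val - b.val := by
  have := a.isLt
  have := b.isLt
  rw [Fin.val_sub]
  split_ifs with h
  · rw [show n - b.val + a.val = a.val - b.val + n by omega, Nat.add_mod_right,
      Nat.mod_eq_of_lt (by omega)]
  · rw [Nat.mod_eq_of_lt (by omega)]
    omega

theorem val_sub_left_injective {n : ℕ} (v : Fin n) :
    Function.Injective fun u : Fin n => (u - v).val := by
  intro a b h
  simp only [val_sub_eq_ite] at h
  have := a.isLt
  have := b.isLt
  have := v.isLt
  ext
  split_ifs at h <;> omega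

theorem val_sub_mem_positions {n : ℕ} {v u : Fin n} {D : Finset (Fin n)} :
    (u - v).val ∈ positions v D ↔ u ∈ D :=
  (val_sub_left_injective v).mem_finset_image

theorem exists_val_sub_eq {n i : ℕ} (v : Fin n) (hi : i < n) : ∃ u : Fin n, (u - v).val = i := by
  have := v.isLt
  by_cases h : v.val + i < n
  · refine ⟨⟨v.val + i, h⟩, ?_⟩
    rw [val_sub_eq_ite]
    dsimp only
    split_ifs <;> omega
  · refine ⟨⟨v.val + i - n, by omega⟩, ?_⟩
    rw [val_sub_eq_ite]
    dsimp only
    split_ifs <;> omega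

theorem cycleGraph_adj_iff_val_sub {n : ℕ} (hn : 3 ≤ n) (v a b : Fin n) :
    (cycleGraph n).Adj a b ↔
      (a - v).val + 1 = (b - v).val ∨ (b - v).val + 1 = (a - v).val ∨
      (a - v).val + 1 = (b - v).val + n ∨ (b - v).val + 1 = (a - v).val + n := by
  rw [cycleGraph_adj']
  simp only [val_sub_eq_ite]
  have := a.isLt
  have := b.isLt
  have := v.isLt
  split_ifs <;> omega

theorem isDomSet_cycleGraph_iff_s7 {n : ℕ} (hn : 3 ≤ n) {v : Fin n} {D : Finset (Fin n)}
    (hv : v ∈ D) :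
    isDomSet (cycleGraph n) D ↔ positions v D ∈ gapSets n D.card := by
  have hvv : (v - v).val = 0 := by
    rw [val_sub_eq_ite, if_pos le_rfl, Nat.sub_self]
  have h0 : 0 ∈ positions v D := hvv ▸ val_sub_mem_positions.2 hv
  have hlt : ∀ i ∈ positions v D, i < n := by
    intro i hi
    obtain ⟨u, -, rfl⟩ := mem_image.1 hi
    exact (u - v).isLt
  have hcard : (positions v D).card = D.card := card_image_of_injective _ (val_sub_left_injective v)
  simp only [mem_gapSets, hcard, h0, implies_true, true_and, and_iff_right hlt]
  constructor
  · intro h i hi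
    obtain ⟨w, hw⟩ := exists_val_sub_eq v (show i + 1 < n by omega)
    by_cases hwD : w ∈ D
    · exact Or.inr (Or.inl (hw ▸ val_sub_mem_positions.2 hwD))
    · obtain ⟨u, hu, hadj⟩ := h w hwD
      rw [cycleGraph_adj_iff_val_sub hn v, hw] at hadj
      have hu' := (val_sub_mem_positions (v := v)).2 hu
      have hun := (u - v).isLt
      obtain h | h : (u - v).val = i ∨ (u - v).val = i + 2 := by omega
      · exact Or.inl (h ▸ hu')
      · exact Or.inr (Or.inr (h ▸ hu'))
  · intro h w hw
    suffices H : ∃ j ∈ positions v D, j + 1 = (w - v).val ∨ (w - v).val + 1 = j ∨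
        j + 1 = (w - v).val + n ∨ (w - v).val + 1 = j + n by
      obtain ⟨j, hj, hjw⟩ := H
      obtain ⟨u, hu, rfl⟩ := mem_image.1 hj
      exact ⟨u, hu, (cycleGraph_adj_iff_val_sub hn v u w).2 hjw⟩
    have hwn := (w - v).isLt
    rw [← val_sub_mem_positions (v := v)] at hw
    generalize (w - v).val = x at hw hwn ⊢
    have hx : x ≠ 0 := fun hx => hw (hx ▸ h0)
    by_cases hxn : x + 1 = n
    · exact ⟨0, h0, by omega⟩
    · rcases h (x - 1) (by omega) with h | h | h
      · exact ⟨_, h, by omega⟩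
      · exact absurd (by rwa [Nat.sub_add_cancel (by omega)] at h) hw
      · exact ⟨_, h, by omega⟩

theorem exists_positions_eq {n k : ℕ} (hn : 0 < n) (v : Fin n) {E : Finset ℕ}
    (hE : E ∈ gapSets n k) : ∃ D : Finset (Fin n), v ∈ D ∧ D.card = k ∧ positions v D = E := by
  obtain ⟨hlt, hc, h0, -⟩ := mem_gapSets.1 hE
  have hpos : positions v (univ.filter fun u => (u - v).val ∈ E) = E := by
    ext i
    simp only [positions, mem_image, mem_filter, mem_univ, true_and]
    constructor
    · rintro ⟨u, hu, rfl⟩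
      exact hu
    · intro hi
      obtain ⟨u, rfl⟩ := exists_val_sub_eq v (hlt i hi)
      exact ⟨u, hi, rfl⟩
  refine ⟨_, ?_, ?_, hpos⟩
  · rw [mem_filter, val_sub_eq_ite, if_pos le_rfl, Nat.sub_self]
    exact ⟨mem_univ _, h0 hn⟩
  · rw [← hc, ← congrArg card hpos]
    exact (card_image_of_injective _ (val_sub_left_injective v)).symm

theorem domNum_cycleGraph_s7 {n : ℕ} (hn : 3 ≤ n) : domNum (cycleGraph n) = (n + 2) / 3 := by
  apply le_antisymm
  · obtain ⟨E, hE⟩ := card_pos.1 (card_gapSets_div_pos (show 1 ≤ n by omega))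
    obtain ⟨D, hv, hc, hD⟩ := exists_positions_eq (by omega) ⟨0, by omega⟩ hE
    exact Nat.sInf_le ⟨D, (isDomSet_cycleGraph_iff_s7 hn hv).2 (by rwa [hD, hc]), hc⟩
  · refine le_csInf ⟨_, univ, fun v hv => absurd (mem_univ v) hv, rfl⟩ ?_
    rintro k ⟨D, hD, rfl⟩
    have hne : D.Nonempty := by
      by_cases h : (⟨0, by omega⟩ : Fin n) ∈ D
      · exact ⟨_, h⟩
      · obtain ⟨u, hu, -⟩ := hD _ h
        exact ⟨u, hu⟩
    obtain ⟨v, hv⟩ := hne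
    have hpos := card_pos.2 ⟨_, (isDomSet_cycleGraph_iff_s7 hn hv).1 hD⟩
    have : ¬ 3 * D.card < n := fun h => hpos.ne' (card_gapSets_of_lt h)
    omega

theorem DV_cycleGraph_eq_card_gapSets {n : ℕ} (hn : 3 ≤ n) (v : Fin n) :
    DV (cycleGraph n) v = (gapSets n ((n + 2) / 3)).card := by
  rw [DV, gammaSets, domNum_cycleGraph_s7 hn]
  refine card_nbij (positions v) ?_ ?_ ?_
  · intro D hD
    simp only [mem_coe, mem_filter, mem_univ, true_and] at hD
    obtain ⟨⟨hdom, hc⟩, hv⟩ := hD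
    exact hc ▸ (isDomSet_cycleGraph_iff_s7 hn hv).1 hdom
  · exact (image_injective (val_sub_left_injective v)).injOn
  · intro E hE
    obtain ⟨D, hv, hc, rfl⟩ := exists_positions_eq (by omega) v hE
    refine ⟨D, ?_, rfl⟩
    simp only [mem_coe, mem_filter, mem_univ, true_and]
    exact ⟨⟨(isDomSet_cycleGraph_iff_s7 hn hv).2 (by rwa [hc]), hc⟩, hv⟩

theorem DV_cycleGraph (n : ℕ) (hn : 3 ≤ n) (v : Fin n) :
    DV (cycleGraph n) v =
      if n % 3 = 0 then 1
      else if n % 3 = 1 then ((n + 2) / 3) * (1 + (n + 2) / 3) / 2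
      else (n + 2) / 3 := by
  rw [DV_cycleGraph_eq_card_gapSets hn, card_gapSets_div n (by omega)]
end

section
/- For n ≥ 2, the domination number of the Cartesian product P_2 □ P_n satisfies γ(P_2 □ P_n) = ⌈(n+1)/2⌉. -/
open SimpleGraph Finset
open scoped Classical

theorem domNum_le_card {V : Type*} [Fintype V] {G : SimpleGraph V} {D : Finset V}
    (hD : isDomSet G D) : domNum G ≤ D.card :=
  Nat.sInf_le ⟨D, hD, rfl⟩

theorem exists_isDomSet_card_eq_domNum {V : Type*} [Fintype V] (G : SimpleGraph V) :
    ∃ D : Finset V, isDomSet G D ∧ D.card = domNum G :=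
  Nat.sInf_mem (s := {n | ∃ D : Finset V, isDomSet G D ∧ D.card = n})
    ⟨_, univ, fun v hv => absurd (mem_univ v) hv, rfl⟩

/-- Lower bounds for the partial sums of a sequence `c` with `2 ≤ c j + 2 * c (j + 1) + c (j + 2)`,
depending on the last two terms. -/
theorem partial_sum_bounds (c : ℕ → ℕ) (h0 : c 0 = 0) (k : ℕ)
    (h : ∀ j < k, 2 ≤ c j + 2 * c (j + 1) + c (j + 2)) :
    k ≤ 2 * ∑ j ∈ range (k + 2), c j ∧
    (1 ≤ c (k + 1) → k + 2 ≤ 2 * ∑ j ∈ range (k + 2), c j) ∧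
    (2 ≤ c (k + 1) → k + 3 ≤ 2 * ∑ j ∈ range (k + 2), c j) ∧
    (1 ≤ c k → k + 1 ≤ 2 * ∑ j ∈ range (k + 2), c j) ∧
    (2 ≤ c k → k + 2 ≤ 2 * ∑ j ∈ range (k + 2), c j) := by
  induction k with
  | zero =>
    simp only [sum_range_succ, sum_range_zero, zero_add]
    omega
  | succ k ih =>
    have ih := ih fun j hj => h j (by omega)
    have hk := h k (by omega)
    rw [show k + 1 + 2 = k + 2 + 1 by rfl, show k + 1 + 1 = k + 2 by rfl, sum_range_succ _ (k + 2)]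
    omega

theorem succ_le_two_mul_sum (c : ℕ → ℕ) (n : ℕ) (hn : 1 ≤ n) (h0 : c 0 = 0) (hlast : c (n + 1) = 0)
    (h : ∀ j < n, 2 ≤ c j + 2 * c (j + 1) + c (j + 2)) :
    n + 1 ≤ 2 * ∑ j ∈ range (n + 2), c j := by
  obtain ⟨m, rfl⟩ := Nat.exists_eq_add_of_le' hn
  have hb := partial_sum_bounds c h0 m fun j hj => h j (by omega)
  have hm := h m (by omega)
  rw [show m + 1 + 2 = m + 2 + 1 by rfl, sum_range_succ _ (m + 2)]
  rw [show m + 1 + 1 = m + 2 by rfl] at hlast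
  omega

theorem isDomSet.two_le_column_card {n : ℕ} {D : Finset (Fin 2 × Fin n)}
    (hD : isDomSet (pathGraph 2 □ pathGraph n) D) {j : ℕ} (hj : j < n) :
    2 ≤ #{x ∈ D | x.2.val + 1 = j} + 2 * #{x ∈ D | x.2.val + 1 = j + 1} +
      #{x ∈ D | x.2.val + 1 = j + 2} := by
  rcases Nat.eq_zero_or_pos #{x ∈ D | x.2.val + 1 = j + 1} with h0 | hpos
  swap
  · omega
  rw [card_eq_zero, filter_eq_empty_iff] at h0
  have key : ∀ r : Fin 2, ∃ u ∈ ({x ∈ D | x.2.val + 1 = j} ∪ {x ∈ D | x.2.val + 1 = j + 2} :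
      Finset (Fin 2 × Fin n)), u.1 = r := by
    intro r
    obtain ⟨u, hu, hadj⟩ := hD (r, ⟨j, hj⟩) fun hm => h0 hm rfl
    refine ⟨u, ?_⟩
    have hne := h0 hu
    rw [boxProd_adj, pathGraph_adj, pathGraph_adj, Fin.ext_iff] at hadj
    dsimp only at hadj
    simp only [mem_union, mem_filter, hu, true_and]
    rcases hadj with ⟨-, h⟩ | ⟨h, h'⟩
    · exact absurd (congrArg (· + 1) h) hne
    · exact ⟨by omega, h'⟩
  choose f hf hfr using key
  have hlt : 1 < #({x ∈ D | x.2.val + 1 = j} ∪ {x ∈ D | x.2.val + 1 = j + 2}) :=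
    one_lt_card.2 ⟨f 0, hf 0, f 1, hf 1, fun h => by
      have := congrArg Prod.fst h
      simp [hfr] at this⟩
  have := card_union_le {x ∈ D | x.2.val + 1 = j} {x ∈ D | x.2.val + 1 = j + 2}
  omega

theorem isDomSet.succ_le_two_mul_card {n : ℕ} (hn : 1 ≤ n) {D : Finset (Fin 2 × Fin n)}
    (hD : isDomSet (pathGraph 2 □ pathGraph n) D) : n + 1 ≤ 2 * D.card := by
  have hmaps : ∀ x ∈ D, x.2.val + 1 ∈ range (n + 2) := fun x _ => mem_range.2 (by omega)
  have hcard : #D = ∑ j ∈ range (n + 2), #{x ∈ D | x.2.val + 1 = j} :=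
    card_eq_sum_card_fiberwise hmaps
  have hfirst : #{x ∈ D | x.2.val + 1 = 0} = 0 :=
    card_eq_zero.2 <| filter_eq_empty_iff.2 fun x _ => Nat.succ_ne_zero _
  have hlast : #{x ∈ D | x.2.val + 1 = n + 1} = 0 :=
    card_eq_zero.2 <| filter_eq_empty_iff.2 fun x _ => by omega
  have hcol : ∀ j < n, 2 ≤ #{x ∈ D | x.2.val + 1 = j} + 2 * #{x ∈ D | x.2.val + 1 = j + 1} +
      #{x ∈ D | x.2.val + 1 = j + 2} := fun j hj => hD.two_le_column_card hj
  obtain ⟨c, hc⟩ : ∃ c : ℕ → ℕ, ∀ j, #{x ∈ D | x.2.val + 1 = j} = c j := ⟨_, fun _ => rfl⟩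
  simp only [hc] at hcard hfirst hlast hcol
  rw [hcard]
  exact succ_le_two_mul_sum c n hn hfirst hlast hcol

/-- The vertices in the even columns of the ladder, in alternating rows, together with one vertex of
the last column. -/
noncomputable def ladderDomSet (n : ℕ) (hn : 0 < n) : Finset (Fin 2 × Fin n) :=
  (range ((n + 2) / 2)).image fun i =>
    (⟨i % 2, Nat.mod_lt _ two_pos⟩, ⟨min (2 * i) (n - 1), by omega⟩)

theorem mem_ladderDomSet {n : ℕ} (hn : 0 < n) {x : Fin 2 × Fin n} :
    x ∈ ladderDomSet n hn ↔
      ∃ i < (n + 2) / 2, i % 2 = x.1.val ∧ min (2 * i) (n - 1) = x.2.val := by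
  simp [ladderDomSet, Prod.ext_iff, Fin.ext_iff]

theorem isDomSet_ladderDomSet {n : ℕ} (hn : 0 < n) :
    isDomSet (pathGraph 2 □ pathGraph n) (ladderDomSet n hn) := by
  rintro ⟨⟨r, hr⟩, ⟨j, hj⟩⟩ hv
  simp only [mem_ladderDomSet, not_exists, not_and] at hv
  have hv₁ := hv (j / 2) (by omega)
  have hv₂ := hv (j / 2 + 1)
  by_cases hpar : j % 2 = 0
  · refine ⟨(⟨1 - r, by omega⟩, ⟨j, hj⟩), (mem_ladderDomSet hn).2 ⟨j / 2, ?_⟩, ?_⟩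
    · dsimp only; omega
    · simp only [boxProd_adj, pathGraph_adj, and_true]; lia
  by_cases hrow : j / 2 % 2 = r
  · refine ⟨(⟨r, hr⟩, ⟨j - 1, by omega⟩), (mem_ladderDomSet hn).2 ⟨j / 2, ?_⟩, ?_⟩
    · dsimp only; omega
    · simp only [boxProd_adj, pathGraph_adj, and_true]; lia
  · have hlt : j + 1 < n := by
      by_contra hlast
      exact hv₂ (by omega) (by omega) (by omega)
    refine ⟨(⟨r, hr⟩, ⟨j + 1, hlt⟩), (mem_ladderDomSet hn).2 ⟨j / 2 + 1, ?_⟩, ?_⟩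
    · dsimp only; omega
    · simp only [boxProd_adj, pathGraph_adj, and_true]; lia

theorem domNum_P2_boxProd_Pn (n : ℕ) (hn : 2 ≤ n) :
    domNum (pathGraph 2 □ pathGraph n) = (n + 2) / 2 := by
  apply le_antisymm
  · have hpos : 0 < n := by omega
    calc domNum (pathGraph 2 □ pathGraph n) ≤ #(ladderDomSet n hpos) :=
          domNum_le_card (isDomSet_ladderDomSet hpos)
      _ ≤ #(range ((n + 2) / 2)) := card_image_le
      _ = (n + 2) / 2 := card_range _
  · obtain ⟨D, hD, hcard⟩ := exists_isDomSet_card_eq_domNum (pathGraph 2 □ pathGraph n)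
    have := hD.succ_le_two_mul_card (by omega)
    omega
end

section
/- Let G = P_2 □ P_n with n ≥ 3, viewed as two copies of P_n with vertices x_1,…,x_n and y_1,…,y_n and edges x_i y_i between them. If there exists a minimum dominating set of G containing no vertex of degree two (that is, containing none of x_1, y_1, x_n, y_n), then n = 3 or n = 6. -/
open SimpleGraph Finset
open scoped Classical

/-- The alternating dominating set of the ladder: one vertex in every other column, with the rows
alternating, the last column being used when the number of columns is even. -/
lemma domNum_ladder_le (n : ℕ) (hn : 0 < n) :
    domNum (pathGraph 2 □ pathGraph n) ≤ n / 2 + 1 := by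
  let f : ℕ → Fin 2 × Fin n := fun k =>
    (if k % 2 = 0 then 0 else 1, ⟨min (2 * k) (n - 1), by omega⟩)
  let D : Finset (Fin 2 × Fin n) := (Finset.range (n / 2 + 1)).image f
  have hfD : ∀ k, k ≤ n / 2 → f k ∈ D := fun k hk =>
    Finset.mem_image_of_mem f (Finset.mem_range.2 (by omega))
  have hdom : isDomSet (pathGraph 2 □ pathGraph n) D := by
    rintro ⟨r, i, hi⟩ hv
    have key : ∀ k, k ≤ n / 2 → f k ≠ (r, ⟨i, hi⟩) := fun k hk e => hv (e ▸ hfD k hk)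
    rcases Nat.even_or_odd' i with ⟨k, rfl | rfl⟩
    · refine ⟨f k, hfD k (by omega), ?_⟩
      have hk := key k (by omega)
      have hmin : min (2 * k) (n - 1) = 2 * k := by omega
      simp only [f, boxProd_adj, pathGraph_adj, hmin] at hk ⊢
      left
      fin_cases r <;> split_ifs at hk ⊢ <;> simp_all
    · by_cases hr : (f k).1 = r
      · refine ⟨f k, hfD k (by omega), ?_⟩
        rw [boxProd_adj]
        right
        refine ⟨?_, hr⟩
        rw [pathGraph_adj]
        simp only [f]
        omega
      · have hr' : (f (k + 1)).1 = r := by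
          simp only [f] at hr ⊢
          fin_cases r <;> split_ifs at hr ⊢ <;> omega
        refine ⟨f (k + 1), hfD (k + 1) (by omega), ?_⟩
        rw [boxProd_adj]
        right
        refine ⟨?_, hr'⟩
        have hne := key (k + 1) (by omega)
        have hval : min (2 * (k + 1)) (n - 1) ≠ 2 * k + 1 := fun e =>
          hne (Prod.ext hr' (Fin.ext e))
        rw [pathGraph_adj]
        simp only [f]
        omega
  calc domNum (pathGraph 2 □ pathGraph n) ≤ D.card := Nat.sInf_le ⟨D, hdom, rfl⟩
    _ ≤ (Finset.range (n / 2 + 1)).card := Finset.card_image_le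
    _ = n / 2 + 1 := Finset.card_range _

/-- The indicator of `D` along row `r` of the ladder, extended by zero. -/
noncomputable def rowIndicator {n : ℕ} (D : Finset (Fin 2 × Fin n)) (r : Fin 2) (i : ℕ) : ℕ :=
  if ∃ h : i < n, (r, ⟨i, h⟩) ∈ D then 1 else 0

section RowIndicator

variable {n : ℕ} (D : Finset (Fin 2 × Fin n))

lemma rowIndicator_le_one (r : Fin 2) (i : ℕ) : rowIndicator D r i ≤ 1 := by
  unfold rowIndicator
  split_ifs <;> omega

lemma rowIndicator_of_le (r : Fin 2) {i : ℕ} (hi : n ≤ i) : rowIndicator D r i = 0 :=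
  if_neg fun ⟨h, _⟩ => absurd h (by omega)

lemma rowIndicator_eq_zero {r : Fin 2} {i : ℕ} (hi : i < n) (h : (r, ⟨i, hi⟩) ∉ D) :
    rowIndicator D r i = 0 :=
  if_neg fun ⟨_, h'⟩ => h h'

lemma rowIndicator_eq_one {r : Fin 2} {i : Fin n} (h : (r, i) ∈ D) : rowIndicator D r i = 1 :=
  if_pos ⟨i.2, h⟩

lemma card_eq_sum_rowIndicator :
    D.card = ∑ i ∈ Finset.range n, (rowIndicator D 0 i + rowIndicator D 1 i) := by
  have hind : ∀ (r : Fin 2) (i : Fin n), rowIndicator D r i = if (r, i) ∈ D then 1 else 0 := by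
    intro r i
    simp [rowIndicator]
  rw [← Fin.sum_univ_eq_sum_range (fun i => rowIndicator D 0 i + rowIndicator D 1 i) n]
  simp only [hind, Finset.sum_add_distrib]
  rw [← Fin.sum_univ_two (fun r : Fin 2 => ∑ i : Fin n, if (r, i) ∈ D then 1 else 0),
    ← Fintype.sum_prod_type' (fun (r : Fin 2) (i : Fin n) => if (r, i) ∈ D then 1 else 0)]
  simp

variable {D}

lemma rowIndicator_dominated (hD : isDomSet (pathGraph 2 □ pathGraph n) D) {r s : Fin 2}
    (hrs : r ≠ s) {i : ℕ} (hi : i < n) :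
    rowIndicator D r i = 1 ∨ rowIndicator D s i = 1 ∨ rowIndicator D r (i + 1) = 1 ∨
      ∃ j, j + 1 = i ∧ rowIndicator D r j = 1 := by
  by_cases hv : (r, ⟨i, hi⟩) ∈ D
  · exact Or.inl (rowIndicator_eq_one D hv)
  · obtain ⟨⟨t, j⟩, hj, hadj⟩ := hD _ hv
    have hone := rowIndicator_eq_one D hj
    rw [boxProd_adj, pathGraph_adj, pathGraph_adj] at hadj
    rcases hadj with ⟨htr, hji⟩ | ⟨hji | hji, htr⟩
    · obtain rfl : t = s := by
        simp only at htr
        omega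
      simp only at hji
      subst hji
      exact Or.inr (Or.inl hone)
    · simp only at hji htr
      subst htr
      exact Or.inr (Or.inr (Or.inr ⟨j, hji, hone⟩))
    · simp only at hji htr
      subst htr
      rw [← hji] at hone
      exact Or.inr (Or.inr (Or.inl hone))

lemma rowIndicator_dominated_zero (hD : isDomSet (pathGraph 2 □ pathGraph n) D) {r s : Fin 2}
    (hrs : r ≠ s) (hn : 0 < n) :
    1 ≤ rowIndicator D r 0 + rowIndicator D s 0 + rowIndicator D r 1 := by
  rcases rowIndicator_dominated hD hrs hn with h | h | h | ⟨j, hj, -⟩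
  · omega
  · omega
  · rw [Nat.zero_add] at h
    omega
  · omega

lemma rowIndicator_dominated_succ (hD : isDomSet (pathGraph 2 □ pathGraph n) D) {r s : Fin 2}
    (hrs : r ≠ s) {i : ℕ} (hi : i + 1 < n) :
    1 ≤ rowIndicator D r i + rowIndicator D r (i + 1) + rowIndicator D r (i + 2) +
      rowIndicator D s (i + 1) := by
  rcases rowIndicator_dominated hD hrs hi with h | h | h | ⟨j, hj, h⟩
  · omega
  · omega
  · have : rowIndicator D r (i + 2) = 1 := h
    omega
  · obtain rfl : j = i := by omega
    omega

end RowIndicator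

/-- Lower bounds on twice a weight `t`, according to the last two columns `(p, q)`, `(p', q')` of
a partial dominating set: `A` if both vertices of the last column are chosen, `B` if exactly one
is; otherwise `C`, `E`, `F` if two, one or none of the vertices of the previous column are. -/
def WeightBound (A B C E F p q p' q' t : ℕ) : Prop :=
  (p' + q' = 2 → A ≤ 2 * t) ∧ (p' + q' = 1 → B ≤ 2 * t) ∧
  (p' + q' = 0 → p + q = 2 → C ≤ 2 * t) ∧ (p' + q' = 0 → p + q = 1 → E ≤ 2 * t) ∧
  (p' + q' = 0 → p + q = 0 → F ≤ 2 * t)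

lemma WeightBound.step {A B C E F A' B' C' E' F' p q p' q' p'' q'' t : ℕ}
    (h : WeightBound A B C E F p q p' q' t)
    (hp : p ≤ 1) (hq : q ≤ 1) (hp' : p' ≤ 1) (hq' : q' ≤ 1) (hp'' : p'' ≤ 1) (hq'' : q'' ≤ 1)
    (hx : 1 ≤ p + p' + p'' + q') (hy : 1 ≤ q + q' + q'' + p')
    (hA : A' ≤ A + 4 ∧ A' ≤ B + 4 ∧ A' ≤ C + 4 ∧ A' ≤ E + 4 ∧ A' ≤ F + 4)
    (hB : B' ≤ A + 2 ∧ B' ≤ B + 2 ∧ B' ≤ C + 2 ∧ B' ≤ E + 2)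
    (hC : C' ≤ A) (hE : E' ≤ B) (hF : F' ≤ C) :
    WeightBound A' B' C' E' F' p' q' p'' q'' (t + (p'' + q'')) := by
  unfold WeightBound at *
  omega

lemma WeightBound.mono {A B C E F A' B' C' E' F' p q p' q' t : ℕ}
    (h : WeightBound A B C E F p q p' q' t)
    (hA : A' ≤ A) (hB : B' ≤ B) (hC : C' ≤ C) (hE : E' ≤ E) (hF : F' ≤ F) :
    WeightBound A' B' C' E' F' p q p' q' t := by
  unfold WeightBound at *
  omega

/-- A dominating set of the ladder with `n` columns avoiding the corners, given by the indicators
`a`, `b` of its two rows, has at least `(n + 3) / 2` elements unless `n = 3` or `n = 6`. -/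
lemma two_mul_sum_ge_of_dominating {a b : ℕ → ℕ} {n : ℕ} (hn : 3 ≤ n) (hn3 : n ≠ 3) (hn6 : n ≠ 6)
    (ha : ∀ i, a i ≤ 1) (hb : ∀ i, b i ≤ 1) (ha0 : a 0 = 0) (hb0 : b 0 = 0)
    (hal : a (n - 1) = 0) (hbl : b (n - 1) = 0) (han : a n = 0) (hbn : b n = 0)
    (ha1 : 1 ≤ a 1) (hb1 : 1 ≤ b 1)
    (hdoma : ∀ i, i + 1 < n → 1 ≤ a i + a (i + 1) + a (i + 2) + b (i + 1))
    (hdomb : ∀ i, i + 1 < n → 1 ≤ b i + b (i + 1) + b (i + 2) + a (i + 1)) :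
    n + 3 ≤ 2 * ∑ i ∈ Finset.range n, (a i + b i) := by
  have step : ∀ {A B C E F : ℕ} (A' B' C' E' F' : ℕ) (k : ℕ), k + 1 < n →
      WeightBound A B C E F (a k) (b k) (a (k + 1)) (b (k + 1))
        (∑ i ∈ Finset.range (k + 2), (a i + b i)) →
      (A' ≤ A + 4 ∧ A' ≤ B + 4 ∧ A' ≤ C + 4 ∧ A' ≤ E + 4 ∧ A' ≤ F + 4) →
      (B' ≤ A + 2 ∧ B' ≤ B + 2 ∧ B' ≤ C + 2 ∧ B' ≤ E + 2) →
      C' ≤ A → E' ≤ B → F' ≤ C →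
      WeightBound A' B' C' E' F' (a (k + 1)) (b (k + 1)) (a (k + 2)) (b (k + 2))
        (∑ i ∈ Finset.range (k + 3), (a i + b i)) := by
    intro A B C E F A' B' C' E' F' k hk h hA hB hC hE hF
    rw [Finset.sum_range_succ _ (k + 2)]
    exact h.step (ha _) (hb _) (ha _) (hb _) (ha _) (hb _) (hdoma k hk) (hdomb k hk) hA hB hC hE hF
  have final : ∀ {A B C E F : ℕ} (k : ℕ), k + 2 = n → n + 3 ≤ C →
      WeightBound A B C E F (a k) (b k) (a (k + 1)) (b (k + 1))
        (∑ i ∈ Finset.range (k + 2), (a i + b i)) →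
      n + 3 ≤ 2 * ∑ i ∈ Finset.range n, (a i + b i) := by
    intro A B C E F k hk hC h
    subst hk
    have h1 := hdoma k (by omega)
    have h2 := hdomb k (by omega)
    have h3 := ha k
    have h4 := hb k
    simp only [Nat.add_succ_sub_one] at hal hbl
    have := h.2.2.1 (by omega) (by omega)
    omega
  have w2 : WeightBound 4 20 20 20 20 (a 0) (b 0) (a 1) (b 1)
      (∑ i ∈ Finset.range 2, (a i + b i)) := by
    have h1 := ha 1
    have h2 := hb 1
    simp only [WeightBound, Finset.sum_range_succ, Finset.sum_range_zero]
    omega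
  have w3 := step 8 6 4 20 20 0 (by omega) w2 (by omega) (by omega) (by omega) (by omega) (by omega)
  have w4 := step 8 6 8 6 4 1 (by omega) w3 (by omega) (by omega) (by omega) (by omega) (by omega)
  by_cases hn4 : n = 4
  · exact final 2 (by omega) (by omega) w4
  have w5 := step 8 8 8 6 8 2 (by omega) w4 (by omega) (by omega) (by omega) (by omega) (by omega)
  by_cases hn5 : n = 5
  · exact final 3 (by omega) (by omega) w5
  have w6 := step 10 8 8 8 8 3 (by omega) w5 (by omega) (by omega) (by omega) (by omega) (by omega)
  have w7 := step 12 10 10 8 8 4 (by omega) w6 (by omega) (by omega) (by omega) (by omega)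
    (by omega)
  have w : ∀ m, m + 7 ≤ n → WeightBound (m + 11) (m + 9) (m + 10) (m + 8) (m + 8)
      (a (m + 5)) (b (m + 5)) (a (m + 6)) (b (m + 6))
      (∑ i ∈ Finset.range (m + 7), (a i + b i)) := by
    intro m
    induction m with
    | zero =>
      intro _
      simpa using w7.mono (by omega) (by omega) (by omega) (by omega) (by omega)
    | succ m ih =>
      intro hm
      have := step (m + 12) (m + 10) (m + 11) (m + 9) (m + 9) (m + 5) (by omega) (ih (by omega))
        (by omega) (by omega) (by omega) (by omega) (by omega)
      convert this using 1
  obtain ⟨m, rfl⟩ : ∃ m, n = m + 7 := ⟨n - 7, by omega⟩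
  exact final (m + 5) rfl le_rfl (w m le_rfl)

theorem no_degree_two_vertex_gamma_set (n : ℕ) (hn : 3 ≤ n)
    (h : ∃ D ∈ gammaSets (pathGraph 2 □ pathGraph n),
      ((0 : Fin 2), (⟨0, by omega⟩ : Fin n)) ∉ D ∧
      ((1 : Fin 2), (⟨0, by omega⟩ : Fin n)) ∉ D ∧
      ((0 : Fin 2), (⟨n - 1, by omega⟩ : Fin n)) ∉ D ∧
      ((1 : Fin 2), (⟨n - 1, by omega⟩ : Fin n)) ∉ D) :
    n = 3 ∨ n = 6 := by
  obtain ⟨D, hD, h1, h2, h3, h4⟩ := h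
  rw [gammaSets, Finset.mem_filter] at hD
  obtain ⟨-, hdom, hcard⟩ := hD
  have hle := domNum_ladder_le n (by omega)
  have hsum := card_eq_sum_rowIndicator D
  have h0 : ∀ r : Fin 2, rowIndicator D r 0 = 0 := by
    intro r
    fin_cases r
    · exact rowIndicator_eq_zero D (by omega) h1
    · exact rowIndicator_eq_zero D (by omega) h2
  have hl : ∀ r : Fin 2, rowIndicator D r (n - 1) = 0 := by
    intro r
    fin_cases r
    · exact rowIndicator_eq_zero D (by omega) h3
    · exact rowIndicator_eq_zero D (by omega) h4
  by_contra hne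
  have hlow := two_mul_sum_ge_of_dominating (a := rowIndicator D 0) (b := rowIndicator D 1)
    (n := n) hn (by omega) (by omega)
    (fun i => rowIndicator_le_one D 0 i) (fun i => rowIndicator_le_one D 1 i)
    (h0 0) (h0 1) (hl 0) (hl 1) (rowIndicator_of_le D 0 le_rfl) (rowIndicator_of_le D 1 le_rfl)
    (by simpa [h0] using rowIndicator_dominated_zero hdom (r := 0) (s := 1) (by decide) (by omega))
    (by simpa [h0] using rowIndicator_dominated_zero hdom (r := 1) (s := 0) (by decide) (by omega))
    (fun i hi => rowIndicator_dominated_succ hdom (r := 0) (s := 1) (by decide) hi)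
    (fun i hi => rowIndicator_dominated_succ hdom (r := 1) (s := 0) (by decide) hi)
  omega
end

section
/- For n ≥ 2, the number τ(P_2 □ P_n) of minimum dominating sets of P_2 □ P_n equals: 6 if n = 2; 3 if n = 3; 17 if n = 6; 2 if n is odd and n ≠ 3; and 2n + 4 if n is even and n ≠ 2, 6. -/
open SimpleGraph Finset
open scoped Classical

namespace Ladder

/-- A column of the ladder, recording for each row whether the vertex is selected. -/
abbrev Column := Fin 2 → Bool

/-- The number of selected vertices of a column. -/
def weight (d : Column) : ℕ := (d 0).toNat + (d 1).toNat

/-- The rows of the column `d` dominated neither from inside `d` nor by the previous column `c`. -/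
def need (c d : Column) : Column := ![!(c 0 || d 0 || d 1), !(c 1 || d 0 || d 1)]

/-- The columns `f` complete a dominating set, where `c` is the column preceding `f 0` and `u` marks
the rows of `c` that still have to be dominated by `f 0`. -/
def Completes : (k : ℕ) → Column → Column → (Fin k → Column) → Prop
  | 0, _, u, _ => ∀ r, u r = false
  | k + 1, c, u, f =>
    (∀ r, u r = true → f 0 r = true) ∧ Completes k (f 0) (need c (f 0)) (Fin.tail f)

/-- The number of completions by `k` columns of total weight `w`, computed column by column. -/
def count : ℕ → ℕ → Column → Column → ℕ
  | 0, w, _, u => if (u 0 || u 1) = false ∧ w = 0 then 1 else 0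
  | k + 1, w, c, u =>
    (if (u 0 || u 1) = false then count k w ![false, false] (need c ![false, false]) else 0) +
    (if u 1 = false ∧ 1 ≤ w then count k (w - 1) ![true, false] (need c ![true, false]) else 0) +
    (if u 0 = false ∧ 1 ≤ w then count k (w - 1) ![false, true] (need c ![false, true]) else 0) +
    (if 2 ≤ w then count k (w - 2) ![true, true] (need c ![true, true]) else 0)

lemma completes_iff (k : ℕ) (c u : Column) (f : Fin k → Column) :
    Completes k c u f ↔ (∀ r, u r = true → ∃ j : Fin k, j.val = 0 ∧ f j r = true) ∧
      ∀ (i : Fin k) (r : Fin 2), (∃ s, f i s = true) ∨ (i.val = 0 ∧ c r = true) ∨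
        (∃ j : Fin k, j.val + 1 = i.val ∧ f j r = true) ∨
        (∃ j : Fin k, i.val + 1 = j.val ∧ f j r = true) := by
  induction k generalizing c u with
  | zero => simp [Completes]
  | succ k ih =>
    rw [Completes, ih]
    simp only [Fin.forall_fin_succ (n := k), Fin.exists_fin_succ (n := k), Fin.tail, Fin.val_zero,
      Fin.val_succ, Nat.add_right_cancel_iff]
    simp only [need, Fin.forall_fin_two, Fin.exists_fin_two]
    simp [eq_comm (a := 0)]
    grind

lemma sum_column (g : Column → ℕ) :
    ∑ d, g d = g ![false, false] + g ![true, false] + g ![false, true] + g ![true, true] := by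
  have h : (univ : Finset Column) =
      {![false, false], ![true, false], ![false, true], ![true, true]} := by decide
  rw [h, sum_insert (by decide), sum_insert (by decide), sum_insert (by decide), sum_singleton]
  ring

lemma card_completes (k w : ℕ) (c u : Column) :
    #{f : Fin k → Column | Completes k c u f ∧ ∑ i, weight (f i) = w} = count k w c u := by
  induction k generalizing w c u with
  | zero =>
    simp only [Completes, count, Fin.forall_fin_two, card_filter]
    simp [eq_comm (a := 0)]
  | succ k ih =>
    have key : ∀ d : Column, (∑ g : Fin k → Column,
        if (((∀ r, u r = true → d r = true) ∧ Completes k d (need c d) g) ∧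
          weight d + ∑ i, weight (g i) = w) then 1 else 0) =
        if (∀ r, u r = true → d r = true) ∧ weight d ≤ w then
          count k (w - weight d) d (need c d) else 0 := by
      intro d
      rw [← ih, card_filter]
      split_ifs with h
      · refine sum_congr rfl fun g _ => if_congr ?_ rfl rfl
        constructor
        · rintro ⟨⟨-, h1⟩, h2⟩
          exact ⟨h1, by omega⟩
        · rintro ⟨h1, h2⟩
          exact ⟨⟨h.1, h1⟩, by omega⟩
      · refine sum_eq_zero fun g _ => if_neg ?_
        rintro ⟨⟨h0, -⟩, h2⟩
        exact h ⟨h0, by omega⟩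
    rw [card_filter, ← (Fin.consEquiv fun _ : Fin (k + 1) => Column).sum_comp,
      Fintype.sum_prod_type]
    simp only [Fin.consEquiv, Equiv.coe_fn_mk, Completes, Fin.cons_zero, Fin.tail_cons,
      Fin.sum_univ_succ (n := k), Fin.cons_succ, key]
    rw [sum_column, count]
    simp [weight, Fin.forall_fin_two]

/-- The set of vertices selected by a sequence of columns. -/
noncomputable def vertices {n : ℕ} (f : Fin n → Column) : Finset (Fin 2 × Fin n) :=
  {x | f x.2 x.1 = true}

lemma mem_vertices {n : ℕ} (f : Fin n → Column) (x : Fin 2 × Fin n) :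
    x ∈ vertices f ↔ f x.2 x.1 = true := by
  simp [vertices]

lemma card_vertices {n : ℕ} (f : Fin n → Column) : #(vertices f) = ∑ i, weight (f i) := by
  rw [vertices, card_filter, Fintype.sum_prod_type_right]
  refine sum_congr rfl fun i _ => ?_
  rw [Fin.sum_univ_two, weight]
  cases f i 0 <;> cases f i 1 <;> simp

lemma isDomSet_vertices {n : ℕ} (f : Fin n → Column) :
    isDomSet (pathGraph 2 □ pathGraph n) (vertices f) ↔
      Completes n ![false, false] ![false, false] f := by
  rw [completes_iff]
  simp only [isDomSet, mem_vertices, boxProd_adj, pathGraph_adj, Prod.forall, Prod.exists,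
    Fin.forall_fin_two, Fin.exists_fin_two]
  simp
  grind

lemma vertices_bijective (n : ℕ) : Function.Bijective (vertices (n := n)) := by
  constructor
  · intro f g h
    funext i r
    have := congrArg ((r, i) ∈ ·) h
    simp only [mem_vertices, eq_iff_iff] at this
    exact Bool.eq_iff_iff.2 this
  · intro D
    refine ⟨fun i r => decide ((r, i) ∈ D), ?_⟩
    ext x
    simp [mem_vertices]

lemma card_isDomSet (n w : ℕ) :
    #{D : Finset (Fin 2 × Fin n) | isDomSet (pathGraph 2 □ pathGraph n) D ∧ #D = w} =
      count n w ![false, false] ![false, false] := by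
  rw [← card_completes, card_filter, card_filter,
    ← (Equiv.ofBijective _ (vertices_bijective n)).sum_comp]
  simp only [Equiv.ofBijective_apply, isDomSet_vertices, card_vertices]

lemma tau_eq_count {n w : ℕ} (hpos : 0 < count n w ![false, false] ![false, false])
    (hmin : ∀ v < w, count n v ![false, false] ![false, false] = 0) :
    tau (pathGraph 2 □ pathGraph n) = count n w ![false, false] ![false, false] := by
  have hdom : domNum (pathGraph 2 □ pathGraph n) = w := by
    rw [← card_isDomSet, card_pos] at hpos
    obtain ⟨D, hD⟩ := hpos
    refine le_antisymm (Nat.sInf_le ⟨D, by simpa using hD⟩)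
      (le_csInf ⟨w, D, by simpa using hD⟩ ?_)
    rintro v ⟨E, hE⟩
    by_contra! hv
    have h := hmin v hv
    rw [← card_isDomSet, card_eq_zero] at h
    exact notMem_empty E (h ▸ by simpa using hE)
  rw [tau, gammaSets, hdom, card_isDomSet]

/-- The number of completions after a column with no selected vertex whose
undominated rows are given by `u`. -/
abbrev afterEmpty (u : Column) (k w : ℕ) : ℕ := count k w ![false, false] u

/-- The number of completions after a nonempty column `c`, which has no undominated rows. -/
abbrev after (c : Column) (k w : ℕ) : ℕ := count k w c ![false, false]

/-- Vanishing of all counts below the least possible weight. -/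
lemma count_eq_zero (k w : ℕ) :
    (2 * w < k + 1 → 0 < k → afterEmpty ![false, false] k w = 0) ∧
    (2 * w < k + 2 → afterEmpty ![true, true] k w = 0) ∧
    (2 * w < k + 1 → afterEmpty ![true, false] k w = 0) ∧
    (2 * w < k + 1 → afterEmpty ![false, true] k w = 0) ∧
    (2 * w < k → after ![true, false] k w = 0) ∧
    (2 * w < k → after ![false, true] k w = 0) ∧
    (2 * w + 1 < k → after ![true, true] k w = 0) := by
  induction k generalizing w with
  | zero => simp [count]
  | succ k ih =>
    simp only [forall_and] at ih
    obtain ⟨h1, h2, h3, h4, h5, h6, h7⟩ := ih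
    refine ⟨fun _ _ => ?_, fun _ => ?_, fun _ => ?_, fun _ => ?_, fun _ => ?_, fun _ => ?_,
      fun _ => ?_⟩ <;> simp [count, need] <;> split_ands <;> intros <;>
      first | apply h1 | apply h2 | apply h3 | apply h4 | apply h5 | apply h6 | apply h7
    all_goals omega

/-- The recurrences for the counts. -/
lemma count_succ_add_two (k w : ℕ) :
    afterEmpty ![false, false] (k + 1) (w + 2) = afterEmpty ![true, true] k (w + 2) +
      after ![true, false] k (w + 1) + after ![false, true] k (w + 1) + after ![true, true] k w ∧
    afterEmpty ![true, true] (k + 1) (w + 2) = after ![true, true] k w ∧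
    afterEmpty ![true, false] (k + 1) (w + 2) =
      after ![true, false] k (w + 1) + after ![true, true] k w ∧
    afterEmpty ![false, true] (k + 1) (w + 2) =
      after ![false, true] k (w + 1) + after ![true, true] k w ∧
    after ![true, false] (k + 1) (w + 2) = afterEmpty ![false, true] k (w + 2) +
      after ![true, false] k (w + 1) + after ![false, true] k (w + 1) + after ![true, true] k w ∧
    after ![false, true] (k + 1) (w + 2) = afterEmpty ![true, false] k (w + 2) +
      after ![true, false] k (w + 1) + after ![false, true] k (w + 1) + after ![true, true] k w ∧
    after ![true, true] (k + 1) (w + 2) = afterEmpty ![false, false] k (w + 2) +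
      after ![true, false] k (w + 1) + after ![false, true] k (w + 1) + after ![true, true] k w := by
  simp [count, need]

/-- The counts needed at the critical weights for `2 * m` columns. -/
structure EvenCounts (m : ℕ) : Prop where
  none : afterEmpty ![false, false] (2 * m) (m + 1) = 4 * m + 4
  both : afterEmpty ![true, true] (2 * m) (m + 1) = 0
  fst : afterEmpty ![true, false] (2 * m) (m + 1) = 2 * m + 1
  snd : afterEmpty ![false, true] (2 * m) (m + 1) = 2 * m + 1
  after_fst : after ![true, false] (2 * m) m = 1
  after_snd : after ![false, true] (2 * m) m = 1
  after_both : after ![true, true] (2 * m) m = 2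

/-- The counts needed at the critical weights for `2 * m + 1` columns. -/
structure OddCounts (m : ℕ) : Prop where
  none : afterEmpty ![false, false] (2 * m + 1) (m + 1) = 2
  both : afterEmpty ![true, true] (2 * m + 1) (m + 2) = 2
  fst : afterEmpty ![true, false] (2 * m + 1) (m + 1) = 1
  snd : afterEmpty ![false, true] (2 * m + 1) (m + 1) = 1
  after_fst : after ![true, false] (2 * m + 1) (m + 1) = 2 * m + 3
  after_snd : after ![false, true] (2 * m + 1) (m + 1) = 2 * m + 3
  after_both : after ![true, true] (2 * m + 1) m = 0

lemma EvenCounts.odd {m : ℕ} (h : EvenCounts (m + 2)) : OddCounts (m + 2) := by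
  obtain ⟨h1, h2, h3, h4, h5, h6, h7⟩ := h
  have z := count_eq_zero (2 * (m + 2)) m
  have z' := count_eq_zero (2 * (m + 2)) (m + 1)
  have z'' := count_eq_zero (2 * (m + 2)) (m + 2)
  have s := count_succ_add_two (2 * (m + 2)) m
  have s' := count_succ_add_two (2 * (m + 2)) (m + 1)
  have s'' := count_succ_add_two (2 * (m + 2)) (m + 2)
  simp only [Nat.add_assoc, Nat.reduceAdd] at *
  constructor <;> (try simp only [Nat.add_assoc, Nat.reduceAdd]) <;> omega

lemma OddCounts.even {m : ℕ} (h : OddCounts (m + 2)) : EvenCounts (m + 3) := by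
  obtain ⟨h1, h2, h3, h4, h5, h6, h7⟩ := h
  have z := count_eq_zero (2 * (m + 2) + 1) (m + 1)
  have z' := count_eq_zero (2 * (m + 2) + 1) (m + 2)
  have s := count_succ_add_two (2 * (m + 2) + 1) (m + 1)
  have s' := count_succ_add_two (2 * (m + 2) + 1) (m + 2)
  have e : 2 * (m + 3) = 2 * (m + 2) + 2 := by ring
  simp only [Nat.add_assoc, Nat.reduceAdd] at *
  constructor <;> simp only [e, Nat.add_assoc, Nat.reduceAdd] <;> omega

lemma evenCounts_four : EvenCounts 4 := by
  constructor <;> decide +kernel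

lemma evenCounts {m : ℕ} (hm : 4 ≤ m) : EvenCounts m := by
  induction m, hm using Nat.le_induction with
  | base => exact evenCounts_four
  | succ m hm ih =>
    obtain ⟨m, rfl⟩ := Nat.exists_eq_add_of_le' (show 2 ≤ m by omega)
    exact ih.odd.even

lemma tau_even {m t : ℕ} (hm : 0 < m) (ht : 0 < t)
    (h : afterEmpty ![false, false] (2 * m) (m + 1) = t) :
    tau (pathGraph 2 □ pathGraph (2 * m)) = t := by
  subst h
  exact tau_eq_count ht fun v hv => (count_eq_zero _ v).1 (by omega) (by omega)

lemma tau_odd {m t : ℕ} (ht : 0 < t)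
    (h : afterEmpty ![false, false] (2 * m + 1) (m + 1) = t) :
    tau (pathGraph 2 □ pathGraph (2 * m + 1)) = t := by
  subst h
  exact tau_eq_count ht fun v hv => (count_eq_zero _ v).1 (by omega) (by omega)

end Ladder

open Ladder in
theorem tau_P2_boxProd_Pn (n : ℕ) (hn : 2 ≤ n) :
    tau (pathGraph 2 □ pathGraph n) =
      if n = 2 then 6
      else if n = 3 then 3
      else if n = 6 then 17
      else if Odd n then 2
      else 2 * n + 4 := by
  obtain ⟨m, rfl | rfl⟩ := Nat.even_or_odd' n
  · have hodd : ¬ Odd (2 * m) := by simp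
    rcases lt_or_ge m 4 with h | h
    · obtain rfl | rfl | rfl : m = 1 ∨ m = 2 ∨ m = 3 := by omega
      · exact tau_even (m := 1) (by norm_num) (by norm_num) (by decide +kernel)
      · rw [tau_even (m := 2) (t := 12) (by norm_num) (by norm_num) (by decide +kernel)]
        simp [hodd]
      · exact tau_even (m := 3) (by norm_num) (by norm_num) (by decide +kernel)
    · rw [tau_even (by omega) (by omega) (evenCounts h).none]
      simp only [hodd, if_false]
      split_ifs <;> omega
  · have hodd : Odd (2 * m + 1) := ⟨m, rfl⟩
    have hval : ∀ l, 2 ≤ l → afterEmpty ![false, false] (2 * l + 1) (l + 1) = 2 := by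
      intro l hl
      rcases lt_or_ge l 4 with h | h
      · obtain rfl | rfl : l = 2 ∨ l = 3 := by omega
        · decide +kernel
        · decide +kernel
      · obtain ⟨j, rfl⟩ := Nat.exists_eq_add_of_le' hl
        exact (evenCounts h).odd.none
    obtain rfl | h : m = 1 ∨ 2 ≤ m := by omega
    · exact tau_odd (m := 1) (by norm_num) (by decide +kernel)
    · rw [tau_odd (by norm_num) (hval m h)]
      simp only [hodd, if_true]
      split_ifs <;> omega
end

section
/- View P_2 □ P_n as two copies of P_n with vertices x_1,…,x_n and y_1,…,y_n and edges x_i y_i. (i) For every vertex v of P_2 □ P_2, DV(v) = 3. (ii) For even n ≥ 4 with n ≠ 6 and 1 ≤ i ≤ n: DV(x_i) = DV(y_i) = n + 2 − i if i is odd and 1 ≤ i ≤ n − 3; DV(x_i) = DV(y_i) = 4 if i = 2 or i = n − 1; and DV(x_i) = DV(y_i) = i + 1 if i is even and 4 ≤ i ≤ n. -/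
open SimpleGraph Finset
open scoped Classical

/-- The middle one `c` of three consecutive columns of the ladder `P_2 □ P_n` is dominated by the
chosen vertices `p`, `c`, `d` of these columns. -/
def ColDom (p c d : Finset (Fin 2)) : Prop := c.Nonempty ∨ p ∪ d = Finset.univ

theorem colDom_comm {p c d : Finset (Fin 2)} : ColDom p c d ↔ ColDom d c p := by
  rw [ColDom, ColDom, Finset.union_comm]

/-- All columns of `c :: l` are dominated, when the column before `c` is `p` and the one after the
end of `l` is empty. -/
def TailDom : Finset (Fin 2) → Finset (Fin 2) → List (Finset (Fin 2)) → Prop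
  | p, c, [] => ColDom p c ∅
  | p, c, d :: l => ColDom p c d ∧ TailDom c d l

theorem tailDom_iff (l : List (Finset (Fin 2))) (p c : Finset (Fin 2)) :
    TailDom p c l ↔ ColDom p c (l.getD 0 ∅) ∧
      ∀ t < l.length, ColDom ((c :: l).getD t ∅) (l.getD t ∅) (l.getD (t + 1) ∅) := by
  induction l generalizing p c with
  | nil => simp [TailDom]
  | cons d l ih =>
    rw [TailDom, ih]
    simp only [List.length_cons, Nat.forall_lt_succ_left, List.getD_cons_zero,
      List.getD_cons_succ]

/-- The number of chosen vertices in a list of columns. -/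
def colWeight (l : List (Finset (Fin 2))) : ℤ := (l.map fun c => (c.card : ℤ)).sum

/-- The lists of `m` columns with `k` chosen vertices which dominate themselves and `c`, when
preceded by the columns `p`, `c`. -/
noncomputable def tails (p c : Finset (Fin 2)) : ℕ → ℤ → Finset (List (Finset (Fin 2)))
  | 0, k => if ColDom p c ∅ ∧ k = 0 then {[]} else ∅
  | m + 1, k => (Finset.univ.filter fun d => ColDom p c d).biUnion fun d =>
      (tails c d m (k - d.card)).image (List.cons d)

theorem mem_tails {m : ℕ} {p c : Finset (Fin 2)} {k : ℤ} {l : List (Finset (Fin 2))} :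
    l ∈ tails p c m k ↔ l.length = m ∧ colWeight l = k ∧ TailDom p c l := by
  induction m generalizing p c k l with
  | zero =>
    cases l with
    | nil =>
      rw [tails]
      split_ifs with h
      · simp [colWeight, TailDom, h]
      · simp only [Finset.notMem_empty, false_iff]
        rintro ⟨-, h1, h2⟩
        exact h ⟨h2, by simpa [colWeight] using h1.symm⟩
    | cons d l =>
      rw [tails]
      split_ifs <;> simp
  | succ m ih =>
    cases l with
    | nil => simp [tails]
    | cons d l =>
      simp only [tails, Finset.mem_biUnion, Finset.mem_filter, Finset.mem_univ, true_and,
        Finset.mem_image, List.cons.injEq, ih, colWeight, TailDom, List.map_cons, List.sum_cons,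
        List.length_cons, Nat.add_right_cancel_iff]
      constructor
      · rintro ⟨d', h1, l', ⟨h2, h3, h4⟩, rfl, rfl⟩
        exact ⟨h2, by omega, h1, h4⟩
      · rintro ⟨h2, h3, h1, h4⟩
        exact ⟨d, h1, l, ⟨h2, by omega, h4⟩, rfl, rfl⟩

theorem card_tails_succ (p c : Finset (Fin 2)) (m : ℕ) (k : ℤ) :
    (tails p c (m + 1) k).card =
      ∑ d : Finset (Fin 2), if ColDom p c d then (tails c d m (k - d.card)).card else 0 := by
  rw [tails, Finset.card_biUnion]
  · rw [Finset.sum_filter]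
    refine Finset.sum_congr rfl fun d _ => ?_
    rw [Finset.card_image_of_injective _ List.cons_injective]
  · intro d _ e _ hde
    refine Finset.disjoint_left.2 ?_
    intro l hl hl'
    simp only [Finset.mem_image] at hl hl'
    obtain ⟨_, -, rfl⟩ := hl
    obtain ⟨_, -, h⟩ := hl'
    exact hde (List.cons.inj h).1.symm

theorem sum_finset_fin_two (f : Finset (Fin 2) → ℕ) :
    ∑ d, f d = f ∅ + f {0} + f {1} + f Finset.univ := by
  have : (Finset.univ : Finset (Finset (Fin 2))) = {∅, {0}, {1}, Finset.univ} := by decide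
  rw [this, Finset.sum_insert (by decide), Finset.sum_insert (by decide),
    Finset.sum_insert (by decide), Finset.sum_singleton]
  ring

theorem tails_of_nonempty {p c : Finset (Fin 2)} (p' : Finset (Fin 2)) (hc : c.Nonempty) (m : ℕ)
    (k : ℤ) : tails p c m k = tails p' c m k := by
  cases m <;> simp [tails, ColDom, hc]

theorem card_tails_zero_of_nonempty (p : Finset (Fin 2)) {c : Finset (Fin 2)} (hc : c.Nonempty)
    (k : ℤ) : (tails p c 0 k).card = if k = 0 then 1 else 0 := by
  simp only [tails, ColDom, hc, true_or, true_and]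
  split_ifs <;> rfl

theorem card_tails_single_succ (a : Fin 2) (m : ℕ) (k : ℤ) :
    (tails ∅ {a} (m + 1) k).card = (tails {a} ∅ m k).card + (tails ∅ {0} m (k - 1)).card +
      (tails ∅ {1} m (k - 1)).card + (tails ∅ Finset.univ m (k - 2)).card := by
  rw [card_tails_succ, sum_finset_fin_two, tails_of_nonempty (p := {a}) (c := {0}) ∅ (by simp),
    tails_of_nonempty (p := {a}) (c := {1}) ∅ (by simp),
    tails_of_nonempty (p := {a}) (c := Finset.univ) ∅ (by simp)]
  simp [ColDom]

theorem card_tails_univ_succ (m : ℕ) (k : ℤ) :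
    (tails ∅ Finset.univ (m + 1) k).card =
      (tails Finset.univ ∅ m k).card + (tails ∅ {0} m (k - 1)).card +
      (tails ∅ {1} m (k - 1)).card + (tails ∅ Finset.univ m (k - 2)).card := by
  rw [card_tails_succ, sum_finset_fin_two,
    tails_of_nonempty (p := Finset.univ) (c := {0}) ∅ (by simp),
    tails_of_nonempty (p := Finset.univ) (c := {1}) ∅ (by simp),
    tails_of_nonempty (p := Finset.univ) (c := Finset.univ) ∅ (by simp)]
  simp [ColDom]

theorem card_tails_univ_empty_succ (m : ℕ) (k : ℤ) :
    (tails Finset.univ ∅ (m + 1) k).card =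
      (tails ∅ ∅ m k).card + (tails ∅ {0} m (k - 1)).card +
      (tails ∅ {1} m (k - 1)).card + (tails ∅ Finset.univ m (k - 2)).card := by
  rw [card_tails_succ, sum_finset_fin_two]
  simp [ColDom]

theorem card_tails_empty_empty_succ (m : ℕ) (k : ℤ) :
    (tails ∅ ∅ (m + 1) k).card = (tails ∅ Finset.univ m (k - 2)).card := by
  rw [card_tails_succ, sum_finset_fin_two]
  have h0 : (∅ : Finset (Fin 2)) ≠ Finset.univ := by decide
  have h1 : ({0} : Finset (Fin 2)) ≠ Finset.univ := by decide
  have h2 : ({1} : Finset (Fin 2)) ≠ Finset.univ := by decide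
  simp [ColDom, h0, h1, h2]

theorem card_tails_single_empty_succ (a : Fin 2) (m : ℕ) (k : ℤ) :
    (tails {a} ∅ (m + 1) k).card =
      (tails ∅ {1 - a} m (k - 1)).card + (tails ∅ Finset.univ m (k - 2)).card := by
  rw [card_tails_succ, sum_finset_fin_two]
  have h0 : ∀ a : Fin 2, ({a} : Finset (Fin 2)) ≠ Finset.univ := by decide
  have h1 : ({0, 1} : Finset (Fin 2)) = Finset.univ := by decide
  have h2 : ({1, 0} : Finset (Fin 2)) = Finset.univ := by decide
  fin_cases a <;> simp [ColDom, h0, h1, h2]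

theorem card_tails_single_empty_zero (a : Fin 2) (k : ℤ) : (tails {a} ∅ 0 k).card = 0 := by
  have h0 : ∀ a : Fin 2, ({a} : Finset (Fin 2)) ≠ Finset.univ := by decide
  simp [tails, ColDom, h0]

theorem card_tails_empty_empty_zero (k : ℤ) : (tails ∅ ∅ 0 k).card = 0 := by
  have h0 : (∅ : Finset (Fin 2)) ≠ Finset.univ := by decide
  simp [tails, ColDom, h0]

theorem card_tails_eq_zero (m : ℕ) :
    (∀ (a : Fin 2) (k : ℤ), 2 * k < m → (tails ∅ {a} m k).card = 0) ∧
    (∀ (a : Fin 2) (k : ℤ), 2 * k < m + 1 → (tails {a} ∅ m k).card = 0) ∧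
    (∀ k : ℤ, 1 ≤ m → 2 * k < m + 1 → (tails Finset.univ ∅ m k).card = 0) ∧
    (∀ k : ℤ, 2 * k < m → ¬ (m = 1 ∧ k = 0) → (tails ∅ Finset.univ m k).card = 0) ∧
    (∀ k : ℤ, 2 * k < m + 3 → ¬ (m = 2 ∧ k = 2) → (tails ∅ ∅ m k).card = 0) := by
  induction m with
  | zero =>
    refine ⟨fun a k hk => ?_, fun a k _ => card_tails_single_empty_zero a k,
      fun k h => by omega, fun k hk _ => ?_, fun k _ _ => card_tails_empty_empty_zero k⟩ <;>
    · rw [card_tails_zero_of_nonempty _ (by simp), if_neg (by omega)]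
  | succ m ih =>
    obtain ⟨hS, hE1, hE0, hB, hE2⟩ := ih
    push_cast
    refine ⟨fun a k hk => ?_, fun a k hk => ?_, fun k _ hk => ?_, fun k hk h => ?_,
      fun k hk h => ?_⟩
    · rw [card_tails_single_succ, hE1 _ _ (by omega), hS _ _ (by omega), hS _ _ (by omega),
        hB _ (by omega) (by omega)]
    · rw [card_tails_single_empty_succ, hS _ _ (by omega), hB _ (by omega) (by omega)]
    · rw [card_tails_univ_empty_succ, hE2 _ (by omega) (by omega), hS _ _ (by omega),
        hS _ _ (by omega), hB _ (by omega) (by omega)]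
    · rw [card_tails_univ_succ, hS _ _ (by omega), hS _ _ (by omega),
        hB _ (by omega) (by omega)]
      rcases Nat.eq_zero_or_pos m with rfl | hm
      · rw [tails, if_neg (by omega)]
        rfl
      · rw [hE0 _ hm (by omega)]
    · rw [card_tails_empty_empty_succ, hB _ (by omega) (by omega)]

theorem card_tails_single_lt {m : ℕ} {k : ℤ} (a : Fin 2) (h : 2 * k < m) :
    (tails ∅ {a} m k).card = 0 := (card_tails_eq_zero m).1 a k h

theorem card_tails_univ_lt {m : ℕ} {k : ℤ} (h : 2 * k < m) (h' : ¬ (m = 1 ∧ k = 0)) :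
    (tails ∅ Finset.univ m k).card = 0 := (card_tails_eq_zero m).2.2.2.1 k h h'

theorem card_tails_single_even (a : Fin 2) (j : ℕ) : (tails ∅ {a} (2 * j) j).card = 1 := by
  induction j generalizing a with
  | zero => simp [card_tails_zero_of_nonempty]
  | succ j ih =>
    rw [show 2 * (j + 1) = 2 * j + 1 + 1 by ring, card_tails_single_succ,
      card_tails_single_lt _ (by push_cast; omega), card_tails_single_lt _ (by push_cast; omega),
      card_tails_univ_lt (by push_cast; omega) (by push_cast; omega),
      card_tails_single_empty_succ, card_tails_univ_lt (by push_cast; omega) (by omega)]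
    push_cast
    rw [add_sub_cancel_right, ih]

theorem card_tails_univ_one : (tails ∅ Finset.univ 1 0).card = 1 := by
  rw [card_tails_univ_succ]
  simp [tails, ColDom]

theorem card_tails_single_one (a : Fin 2) : (tails ∅ {a} 1 1).card = 2 := by
  rw [card_tails_single_succ]
  simp [card_tails_zero_of_nonempty, card_tails_single_empty_zero]

theorem card_tails_single_odd_succ (a : Fin 2) (j : ℕ) :
    (tails ∅ {a} (2 * (j + 1) + 1) (j + 2)).card =
      (tails ∅ {1 - a} (2 * j + 1) (j + 1)).card + (tails ∅ Finset.univ (2 * j + 1) j).card + 2 := by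
  have h0 := card_tails_single_even 0 (j + 1)
  have h1 := card_tails_single_even 1 (j + 1)
  push_cast at h0 h1
  rw [card_tails_single_succ, card_tails_univ_lt (by push_cast; omega) (by omega),
    show (j + 2 - 1 : ℤ) = j + 1 by ring, h0, h1, show 2 * (j + 1) = 2 * j + 1 + 1 by ring,
    card_tails_single_empty_succ, show (j + 2 - 1 : ℤ) = j + 1 by ring, add_sub_cancel_right]

theorem card_tails_single_odd (a : Fin 2) (j : ℕ) :
    (tails ∅ {a} (2 * (j + 1) + 1) (j + 2)).card = 2 * (j + 1) + 3 := by
  induction j generalizing a with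
  | zero =>
    rw [card_tails_single_odd_succ]
    simp [card_tails_single_one, card_tails_univ_one]
  | succ j ih =>
    have := ih (1 - a)
    rw [card_tails_single_odd_succ, card_tails_univ_lt (by push_cast; omega) (by omega)]
    push_cast
    rw [add_assoc, one_add_one_eq_two, this]
    ring

theorem card_tails_univ_even {j : ℕ} (hj : j ≠ 1) :
    (tails ∅ Finset.univ (2 * (j + 1)) (j + 1)).card = 2 := by
  rw [show 2 * (j + 1) = 2 * j + 1 + 1 by ring, card_tails_univ_succ,
    card_tails_single_lt _ (by push_cast; omega), card_tails_single_lt _ (by push_cast; omega),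
    card_tails_univ_lt (by push_cast; omega) (by omega), card_tails_univ_empty_succ,
    (card_tails_eq_zero (2 * j)).2.2.2.2 _ (by push_cast; omega) (by omega),
    card_tails_univ_lt (by push_cast; omega) (by omega), add_sub_cancel_right,
    card_tails_single_even, card_tails_single_even]

/-- The pairs of lists of `p` and `q` columns with `k` chosen vertices which dominate themselves
when attached on both sides of a column `c`. -/
noncomputable def armPairs (c : Finset (Fin 2)) (p q : ℕ) (k : ℤ) :
    Finset (List (Finset (Fin 2)) × List (Finset (Fin 2))) :=
  (Finset.Icc 0 k).biUnion fun s => tails ∅ c p s ×ˢ tails ∅ c q (k - s)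

theorem colWeight_nonneg (l : List (Finset (Fin 2))) : 0 ≤ colWeight l :=
  List.sum_nonneg (by simp)

theorem mem_armPairs {c : Finset (Fin 2)} {p q : ℕ} {k : ℤ}
    {x : List (Finset (Fin 2)) × List (Finset (Fin 2))} :
    x ∈ armPairs c p q k ↔ x.1.length = p ∧ x.2.length = q ∧
      colWeight x.1 + colWeight x.2 = k ∧ TailDom ∅ c x.1 ∧ TailDom ∅ c x.2 := by
  simp only [armPairs, Finset.mem_biUnion, Finset.mem_product, mem_tails, Finset.mem_Icc]
  constructor
  · rintro ⟨s, hs, ⟨h1, h2, h3⟩, h4, h5, h6⟩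
    exact ⟨h1, h4, by omega, h3, h6⟩
  · rintro ⟨h1, h2, h3, h4, h5⟩
    have := colWeight_nonneg x.1
    have := colWeight_nonneg x.2
    exact ⟨colWeight x.1, ⟨by omega, by omega⟩, ⟨h1, rfl, h4⟩, h2, by omega, h5⟩

theorem card_armPairs_comm (c : Finset (Fin 2)) (p q : ℕ) (k : ℤ) :
    (armPairs c p q k).card = (armPairs c q p k).card := by
  refine Finset.card_nbij' Prod.swap Prod.swap ?_ ?_ (fun _ _ => rfl) (fun _ _ => rfl) <;>
  · intro x hx
    simp only [Finset.mem_coe, mem_armPairs, Prod.fst_swap, Prod.snd_swap] at hx ⊢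
    obtain ⟨h1, h2, h3, h4, h5⟩ := hx
    exact ⟨h2, h1, by omega, h5, h4⟩

theorem card_armPairs_eq_zero {c : Finset (Fin 2)} {p q : ℕ} {k α β : ℤ}
    (hp : ∀ s < α, (tails ∅ c p s).card = 0) (hq : ∀ s < β, (tails ∅ c q s).card = 0)
    (hk : k < α + β) : (armPairs c p q k).card = 0 := by
  simp only [Finset.card_eq_zero] at *
  refine Finset.eq_empty_of_forall_notMem fun x hx => ?_
  rw [armPairs, Finset.mem_biUnion] at hx
  obtain ⟨s, -, hx⟩ := hx
  rcases lt_or_ge s α with h | h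
  · simp [hp s h] at hx
  · simp [hq (k - s) (by omega)] at hx

theorem card_armPairs_eq_mul {c : Finset (Fin 2)} {p q : ℕ} {k α β : ℤ}
    (hp : ∀ s < α, (tails ∅ c p s).card = 0) (hq : ∀ s < β, (tails ∅ c q s).card = 0)
    (hk : k = α + β) :
    (armPairs c p q k).card = (tails ∅ c p α).card * (tails ∅ c q β).card := by
  rw [← Finset.card_product]
  congr 1
  ext x
  simp only [Finset.card_eq_zero] at hp hq
  simp only [mem_armPairs, Finset.mem_product, mem_tails]
  constructor
  · rintro ⟨h1, h2, h3, h4, h5⟩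
    have hα : ¬ colWeight x.1 < α := fun h => by
      have : x.1 ∈ tails ∅ c p (colWeight x.1) := mem_tails.2 ⟨h1, rfl, h4⟩
      simp [hp _ h] at this
    have hβ : ¬ colWeight x.2 < β := fun h => by
      have : x.2 ∈ tails ∅ c q (colWeight x.2) := mem_tails.2 ⟨h2, rfl, h5⟩
      simp [hq _ h] at this
    exact ⟨⟨h1, by omega, h4⟩, h2, by omega, h5⟩
  · rintro ⟨⟨h1, h2, h3⟩, h4, h5, h6⟩
    exact ⟨h1, h4, by omega, h3, h6⟩

/-- The `j`-th column of a set of vertices of the ladder, empty when `j` is out of range. -/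
noncomputable def column {n : ℕ} (D : Finset (Fin 2 × Fin n)) (j : ℤ) : Finset (Fin 2) :=
  Finset.univ.filter fun a => ∃ x : Fin n, (x : ℤ) = j ∧ (a, x) ∈ D

theorem mem_column {n : ℕ} {D : Finset (Fin 2 × Fin n)} {j : ℤ} {a : Fin 2} :
    a ∈ column D j ↔ ∃ x : Fin n, (x : ℤ) = j ∧ (a, x) ∈ D := by
  simp [column]

theorem mem_column_val {n : ℕ} {D : Finset (Fin 2 × Fin n)} {x : Fin n} {a : Fin 2} :
    a ∈ column D x ↔ (a, x) ∈ D := by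
  rw [mem_column]
  constructor
  · rintro ⟨y, hy, h⟩
    rwa [Fin.ext (by omega : (y : ℕ) = x)] at h
  · exact fun h => ⟨x, rfl, h⟩

theorem column_eq_empty {n : ℕ} (D : Finset (Fin 2 × Fin n)) {j : ℤ} (hj : j < 0 ∨ n ≤ j) :
    column D j = ∅ := by
  refine Finset.eq_empty_of_forall_notMem fun a ha => ?_
  obtain ⟨x, hx, -⟩ := mem_column.1 ha
  have := x.2
  omega

theorem isDomSet_ladder_iff {n : ℕ} {D : Finset (Fin 2 × Fin n)} :
    isDomSet (pathGraph 2 □ pathGraph n) D ↔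
      ∀ x : Fin n, ColDom (column D (x - 1)) (column D x) (column D (x + 1)) := by
  constructor
  · intro h x
    rw [ColDom, or_iff_not_imp_left, Finset.not_nonempty_iff_eq_empty]
    intro hx
    have hD : ∀ a, (a, x) ∉ D := fun a ha => by
      have := mem_column_val.2 ha
      simp [hx] at this
    refine Finset.eq_univ_of_forall fun a => ?_
    obtain ⟨⟨b, y⟩, hu, hadj⟩ := h (a, x) (hD a)
    simp only [boxProd_adj, pathGraph_adj] at hadj
    rw [Finset.mem_union, mem_column, mem_column]
    rcases hadj with ⟨-, h2⟩ | ⟨h1, h2⟩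
    · subst h2
      exact absurd hu (hD b)
    · subst h2
      rcases h1 with h1 | h1
      · exact Or.inl ⟨y, by omega, hu⟩
      · exact Or.inr ⟨y, by omega, hu⟩
  · rintro h ⟨a, x⟩ hv
    rcases h x with ⟨b, hb⟩ | hx
    · rw [mem_column_val] at hb
      refine ⟨(b, x), hb, ?_⟩
      have hab : (a : ℕ) ≠ b := fun hab => hv (Fin.ext hab ▸ hb)
      simp only [boxProd_adj, pathGraph_adj]
      exact Or.inl ⟨by omega, trivial⟩
    · have ha : a ∈ column D (x - 1) ∪ column D (x + 1) := hx ▸ Finset.mem_univ a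
      simp only [Finset.mem_union, mem_column] at ha
      rcases ha with ⟨y, hy, hD⟩ | ⟨y, hy, hD⟩
      · refine ⟨(a, y), hD, ?_⟩
        simp only [boxProd_adj, pathGraph_adj]
        exact Or.inr ⟨by omega, trivial⟩
      · refine ⟨(a, y), hD, ?_⟩
        simp only [boxProd_adj, pathGraph_adj]
        exact Or.inr ⟨by omega, trivial⟩

theorem card_eq_sum_column {n : ℕ} (D : Finset (Fin 2 × Fin n)) :
    D.card = ∑ x ∈ Finset.range n, (column D x).card := by
  rw [Finset.sum_range, Finset.card_eq_sum_card_fiberwise (f := Prod.snd) (t := Finset.univ)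
    (by simp)]
  refine Finset.sum_congr rfl fun x _ => ?_
  refine Finset.card_nbij' Prod.fst (fun a => (a, x)) ?_ ?_ ?_ ?_
  · rintro ⟨a, y⟩ h
    simp only [Finset.coe_filter, Set.mem_ofPred_eq] at h
    obtain ⟨h1, rfl⟩ := h
    exact mem_column_val.2 h1
  · intro a ha
    simpa using mem_column_val.1 ha
  · rintro ⟨a, y⟩ h
    simp only [Finset.coe_filter, Set.mem_ofPred_eq] at h
    simp [h.2]
  · intro a _
    rfl

/-- The list `f 1, …, f m`. -/
def arm (f : ℕ → Finset (Fin 2)) (m : ℕ) : List (Finset (Fin 2)) :=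
  (List.range m).map fun t => f (t + 1)

theorem arm_getD {f : ℕ → Finset (Fin 2)} {m : ℕ} (hf : ∀ t, m < t → f t = ∅) (t : ℕ) :
    (arm f m).getD t ∅ = f (t + 1) := by
  rcases lt_or_ge t m with h | h
  · rw [List.getD_eq_getElem _ _ (by simpa [arm] using h)]
    simp [arm]
  · rw [List.getD_eq_default _ _ (by simpa [arm] using h), hf _ (by omega)]

theorem tailDom_arm_iff {f : ℕ → Finset (Fin 2)} {m : ℕ} (hf : ∀ t, m < t → f t = ∅)
    (h0 : (f 0).Nonempty) : TailDom ∅ (f 0) (arm f m) ↔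
      ∀ t < m, ColDom (f t) (f (t + 1)) (f (t + 2)) := by
  rw [tailDom_iff, and_iff_right (show ColDom _ _ _ from Or.inl h0), show (arm f m).length = m by simp [arm]]
  refine forall₂_congr fun t _ => ?_
  rw [arm_getD hf, arm_getD hf]
  cases t with
  | zero => rfl
  | succ t => rw [List.getD_cons_succ, arm_getD hf]

theorem colWeight_arm (f : ℕ → Finset (Fin 2)) (m : ℕ) :
    colWeight (arm f m) = ∑ t ∈ Finset.range m, ((f (t + 1)).card : ℤ) := by
  simp only [colWeight, arm, List.map_map]
  rfl

/-- The columns of `D` on both sides of the `p`-th one, read away from it. -/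
noncomputable def arms {n : ℕ} (p q : ℕ) (D : Finset (Fin 2 × Fin n)) :
    List (Finset (Fin 2)) × List (Finset (Fin 2)) :=
  (arm (fun t => column D (p - t)) p, arm (fun t => column D (p + t)) q)

theorem arms_mem_armPairs {n p q : ℕ} (hn : n = p + 1 + q) {D : Finset (Fin 2 × Fin n)}
    (hD : (column D p).Nonempty) (k : ℤ) :
    arms p q D ∈ armPairs (column D p) p q (k - (column D p).card) ↔
      isDomSet (pathGraph 2 □ pathGraph n) D ∧ (D.card : ℤ) = k := by
  have hl := tailDom_arm_iff (f := fun t => column D (p - t)) (m := p)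
    (fun t ht => column_eq_empty D (by omega)) (by simpa using hD)
  have hr := tailDom_arm_iff (f := fun t => column D (p + t)) (m := q)
    (fun t ht => column_eq_empty D (by omega)) (by simpa using hD)
  simp only [Nat.cast_zero, sub_zero, add_zero] at hl hr
  simp only [mem_armPairs, arms, hl, hr, isDomSet_ladder_iff]
  have hcard : (D.card : ℤ) = colWeight (arm (fun t => column D (p - t)) p) +
      (column D p).card + colWeight (arm (fun t => column D (p + t)) q) := by
    rw [card_eq_sum_column, congrArg Finset.range hn, Finset.sum_range_add, Finset.sum_range_succ, colWeight_arm,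
      colWeight_arm, ← Finset.sum_range_reflect]
    push_cast
    congr 1
    · congr 1
      refine Finset.sum_congr rfl fun t ht => ?_
      rw [Finset.mem_range] at ht
      rw [show ((p - 1 - t : ℕ) : ℤ) = p - (t + 1) by omega]
    · refine Finset.sum_congr rfl fun t _ => ?_
      rw [show ((p : ℤ) + 1 + t) = p + (t + 1) by ring]
  rw [hcard]
  constructor
  · rintro ⟨-, -, hk, h1, h2⟩
    refine ⟨fun x => ?_, by omega⟩
    rcases lt_trichotomy (x : ℕ) p with hx | hx | hx
    · have := colDom_comm.1 (h1 (p - 1 - x) (by omega))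
      convert this using 2 <;> omega
    · exact Or.inl (hx ▸ hD)
    · have := h2 (x - p - 1) (by omega)
      convert this using 2 <;> omega
  · rintro ⟨h, hk⟩
    refine ⟨by simp [arm], by simp [arm], by omega, fun t ht => ?_, fun t ht => ?_⟩
    · have := colDom_comm.1 (h ⟨p - 1 - t, by omega⟩)
      convert this using 2 <;> dsimp only <;> omega
    · have := h ⟨p + 1 + t, by omega⟩
      convert this using 2 <;> push_cast <;> ring

theorem eq_of_arms_eq {n p q : ℕ} (hn : n = p + 1 + q) {D E : Finset (Fin 2 × Fin n)}
    (hc : column D p = column E p) (h : arms p q D = arms p q E) : D = E := by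
  simp only [arms, arm, Prod.mk.injEq, List.map_inj_left, List.mem_range] at h
  ext ⟨a, x⟩
  suffices h : column D x = column E x by rw [← mem_column_val, h, mem_column_val]
  rcases lt_trichotomy (x : ℕ) p with hx | hx | hx
  · convert h.1 (p - 1 - x) (by omega) using 2 <;> omega
  · rwa [hx]
  · convert h.2 (x - p - 1) (by omega) using 2 <;> omega

theorem exists_arms_eq {n p q : ℕ} (hn : n = p + 1 + q) (c : Finset (Fin 2))
    {l r : List (Finset (Fin 2))} (hl : l.length = p) (hr : r.length = q) :
    ∃ D : Finset (Fin 2 × Fin n), column D p = c ∧ arms p q D = (l, r) := by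
  let g : ℕ → Finset (Fin 2) := fun x =>
    if x < p then l.getD (p - 1 - x) ∅ else if x = p then c else r.getD (x - p - 1) ∅
  let D : Finset (Fin 2 × Fin n) := Finset.univ.filter fun y => y.1 ∈ g y.2
  have hD : ∀ x : ℕ, x < n → column D x = g x := fun x hx => by
    ext a
    rw [show (x : ℤ) = ((⟨x, hx⟩ : Fin n) : ℕ) from rfl, mem_column_val]
    simp [D]
  refine ⟨D, by rw [hD p (by omega)]; simp [g], ?_⟩
  rw [arms, Prod.mk.injEq]
  constructor
  · refine List.ext_getElem (by simp [arm, hl]) fun t ht ht' => ?_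
    simp only [arm, List.getElem_map, List.getElem_range]
    rw [show (p : ℤ) - (t + 1 : ℕ) = (p - 1 - t : ℕ) by omega, hD _ (by omega)]
    simp only [g]
    rw [if_pos (by omega), show p - 1 - (p - 1 - t) = t by omega, List.getD_eq_getElem _ _ ht']
  · refine List.ext_getElem (by simp [arm, hr]) fun t ht ht' => ?_
    simp only [arm, List.getElem_map, List.getElem_range]
    rw [show (p : ℤ) + (t + 1 : ℕ) = (p + 1 + t : ℕ) by push_cast; ring, hD _ (by omega)]
    simp only [g]
    rw [if_neg (by omega), if_neg (by omega), show p + 1 + t - p - 1 = t by omega,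
      List.getD_eq_getElem _ _ ht']

theorem card_domSets_column {n p q : ℕ} (hn : n = p + 1 + q) {c : Finset (Fin 2)}
    (hc : c.Nonempty) (k : ℤ) :
    (Finset.univ.filter fun D : Finset (Fin 2 × Fin n) =>
      (isDomSet (pathGraph 2 □ pathGraph n) D ∧ (D.card : ℤ) = k) ∧ column D p = c).card =
      (armPairs c p q (k - c.card)).card := by
  refine Finset.card_bij (fun D _ => arms p q D) ?_ ?_ ?_
  · intro D hD
    obtain ⟨h, rfl⟩ := (Finset.mem_filter.1 hD).2
    exact (arms_mem_armPairs hn hc k).2 h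
  · intro D hD E hE h
    exact eq_of_arms_eq hn
      ((Finset.mem_filter.1 hD).2.2.trans (Finset.mem_filter.1 hE).2.2.symm) h
  · rintro ⟨l, r⟩ h
    obtain ⟨h1, h2, -⟩ := mem_armPairs.1 h
    obtain ⟨D, rfl, hD⟩ := exists_arms_eq hn c h1 h2
    refine ⟨D, ?_, hD⟩
    rw [← hD, arms_mem_armPairs hn hc] at h
    simp [h]

theorem card_domSets_mem {n p q : ℕ} (hn : n = p + 1 + q) (a : Fin 2) (x : Fin n)
    (hx : (x : ℕ) = p) (k : ℤ) :
    (Finset.univ.filter fun D : Finset (Fin 2 × Fin n) =>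
      (isDomSet (pathGraph 2 □ pathGraph n) D ∧ (D.card : ℤ) = k) ∧ (a, x) ∈ D).card =
      (armPairs {a} p q (k - 1)).card + (armPairs Finset.univ p q (k - 2)).card := by
  have h1 := card_domSets_column hn (Finset.singleton_nonempty a) k
  have h2 := card_domSets_column hn (Finset.univ_nonempty (α := Fin 2)) k
  rw [Finset.card_singleton, Nat.cast_one] at h1
  rw [Finset.card_univ, Fintype.card_fin, Nat.cast_ofNat] at h2
  have hne : ∀ a : Fin 2, ({a} : Finset (Fin 2)) ≠ Finset.univ := by decide
  have hmem : ∀ (a : Fin 2) (c : Finset (Fin 2)), a ∈ c ↔ c = {a} ∨ c = Finset.univ := by decide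
  rw [← h1, ← h2, ← Finset.card_union_of_disjoint, ← Finset.filter_or]
  · congr 1
    refine Finset.filter_congr fun D _ => ?_
    rw [← mem_column_val, hmem, hx]
    tauto
  · refine Finset.disjoint_filter.2 fun D _ h h' => hne a ?_
    rw [← h.2, ← h'.2]

theorem card_armPairs_add_eq_zero (a : Fin 2) (s t : ℕ) {k : ℤ} (hk : k ≤ s + t + 1) :
    (armPairs {a} (2 * s) (2 * t + 1) (k - 1)).card +
      (armPairs Finset.univ (2 * s) (2 * t + 1) (k - 2)).card = 0 := by
  rw [card_armPairs_eq_zero (α := s) (β := t + 1), card_armPairs_eq_zero (α := s) (β := t)]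
  · exact fun k hk => card_tails_univ_lt (by push_cast; omega) (by omega)
  · exact fun k hk => card_tails_univ_lt (by push_cast; omega) (by omega)
  · omega
  · exact fun k hk => card_tails_single_lt a (by push_cast; omega)
  · exact fun k hk => card_tails_single_lt a (by push_cast; omega)
  · omega

theorem card_armPairs_add (a : Fin 2) (s t : ℕ) :
    (armPairs {a} (2 * s) (2 * t + 1) (s + t + 2 - 1)).card +
      (armPairs Finset.univ (2 * s) (2 * t + 1) (s + t + 2 - 2)).card =
      if t = 0 then 2 + (tails ∅ Finset.univ (2 * s) s).card else 2 * t + 3 := by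
  rw [card_armPairs_eq_mul (α := s) (β := t + 1)]
  rotate_left
  · exact fun k hk => card_tails_single_lt a (by push_cast; omega)
  · exact fun k hk => card_tails_single_lt a (by push_cast; omega)
  · ring
  rw [card_tails_single_even, one_mul]
  cases t with
  | zero =>
    rw [card_armPairs_eq_mul (α := s) (β := 0)]
    · simp [card_tails_single_one, card_tails_univ_one]
    · exact fun k hk => card_tails_univ_lt (by push_cast; omega) (by omega)
    · exact fun k hk => card_tails_univ_lt (by push_cast; omega) (by omega)
    · simp
  | succ t =>
    rw [card_armPairs_eq_zero (α := s) (β := t + 2)]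
    · have := card_tails_single_odd a t
      push_cast
      rw [add_assoc (t : ℤ), one_add_one_eq_two, this]
    · exact fun k hk => card_tails_univ_lt (by push_cast; omega) (by omega)
    · exact fun k hk => card_tails_univ_lt (by push_cast; omega) (by omega)
    · push_cast
      omega

theorem exists_eq_two_mul {n : ℕ} (x : Fin n) (hn : Even n) : ∃ s t : ℕ, n = 2 * (s + t + 1) ∧
    ((x : ℕ) = 2 * s ∨ (x : ℕ) = 2 * t + 1) := by
  obtain ⟨h, rfl⟩ := hn
  have := x.2
  rcases Nat.even_or_odd' (x : ℕ) with ⟨s, hs | hs⟩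
  · exact ⟨s, h - s - 1, by omega, Or.inl hs⟩
  · exact ⟨h - s - 1, s, by omega, Or.inr hs⟩

theorem card_domSets_mem_even {n s t : ℕ} (hn : n = 2 * (s + t + 1)) (a : Fin 2) (x : Fin n)
    (hx : (x : ℕ) = 2 * s ∨ (x : ℕ) = 2 * t + 1) (k : ℤ) :
    (Finset.univ.filter fun D : Finset (Fin 2 × Fin n) =>
      (isDomSet (pathGraph 2 □ pathGraph n) D ∧ (D.card : ℤ) = k) ∧ (a, x) ∈ D).card =
    (armPairs {a} (2 * s) (2 * t + 1) (k - 1)).card +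
      (armPairs Finset.univ (2 * s) (2 * t + 1) (k - 2)).card := by
  rcases hx with hx | hx
  · rw [card_domSets_mem (q := 2 * t + 1) (by omega) a x hx]
  · rw [card_domSets_mem (q := 2 * s) (by omega) a x hx, card_armPairs_comm,
      card_armPairs_comm Finset.univ]

theorem domNum_ladder_even {h : ℕ} (hh : 1 ≤ h) :
    domNum (pathGraph 2 □ pathGraph (2 * h)) = h + 1 := by
  have hlow : ∀ D : Finset (Fin 2 × Fin (2 * h)),
      isDomSet (pathGraph 2 □ pathGraph (2 * h)) D → h + 1 ≤ D.card := fun D hD => by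
    have hne : D.Nonempty := by
      by_contra hne
      rw [Finset.not_nonempty_iff_eq_empty] at hne
      subst hne
      obtain ⟨u, hu, -⟩ := hD (0, ⟨0, by omega⟩) (by simp)
      simp at hu
    obtain ⟨⟨a, x⟩, hax⟩ := hne
    by_contra hlt
    obtain ⟨s, t, hn, hx⟩ := exists_eq_two_mul x (even_two_mul h)
    have := card_domSets_mem_even hn a x hx D.card
    rw [card_armPairs_add_eq_zero a s t (by omega), Finset.card_eq_zero,
      Finset.filter_eq_empty_iff] at this
    exact this (Finset.mem_univ D) ⟨⟨hD, rfl⟩, hax⟩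
  have hex : ∃ D : Finset (Fin 2 × Fin (2 * h)),
      isDomSet (pathGraph 2 □ pathGraph (2 * h)) D ∧ D.card = h + 1 := by
    obtain ⟨s, t, hn, hx⟩ := exists_eq_two_mul (⟨0, by omega⟩ : Fin (2 * h)) (even_two_mul h)
    have := card_domSets_mem_even hn 0 _ hx (s + t + 2)
    rw [card_armPairs_add] at this
    obtain ⟨D, hD⟩ := Finset.card_pos.1 (this ▸ (by split_ifs <;> omega : 0 < if t = 0 then
      2 + (tails ∅ Finset.univ (2 * s) s).card else 2 * t + 3))
    obtain ⟨⟨h1, h2⟩, -⟩ := (Finset.mem_filter.1 hD).2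
    exact ⟨D, h1, by omega⟩
  refine le_antisymm (Nat.sInf_le hex) ?_
  refine le_csInf ⟨_, hex⟩ ?_
  rintro _ ⟨D, hD, rfl⟩
  exact hlow D hD

theorem DV_ladder {n s t : ℕ} (hn : n = 2 * (s + t + 1)) (a : Fin 2) (x : Fin n)
    (hx : (x : ℕ) = 2 * s ∨ (x : ℕ) = 2 * t + 1) :
    DV (pathGraph 2 □ pathGraph n) (a, x) =
      if t = 0 then 2 + (tails ∅ Finset.univ (2 * s) s).card else 2 * t + 3 := by
  rw [← card_armPairs_add a, ← card_domSets_mem_even hn a x hx, DV, gammaSets]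
  congr 1
  ext D
  simp only [Finset.mem_filter, Finset.mem_univ, true_and]
  rw [show domNum (pathGraph 2 □ pathGraph n) = s + t + 1 + 1 by
    subst hn; exact domNum_ladder_even (by omega)]
  have : D.card = s + t + 1 + 1 ↔ (D.card : ℤ) = s + t + 2 := by omega
  rw [this]

theorem DV_ladder_of_pos {n s t : ℕ} (hn : n = 2 * (s + t + 1)) (ht : t ≠ 0) (a : Fin 2)
    (x : Fin n) (hx : (x : ℕ) = 2 * s ∨ (x : ℕ) = 2 * t + 1) :
    DV (pathGraph 2 □ pathGraph n) (a, x) = 2 * t + 3 := by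
  rw [DV_ladder hn a x hx, if_neg ht]

theorem DV_ladder_of_zero {n s : ℕ} (hn : n = 2 * (s + 1)) (hs : s ≠ 0) (hs' : s ≠ 2)
    (a : Fin 2) (x : Fin n) (hx : (x : ℕ) = 2 * s ∨ (x : ℕ) = 1) :
    DV (pathGraph 2 □ pathGraph n) (a, x) = 4 := by
  obtain ⟨s, rfl⟩ := Nat.exists_eq_succ_of_ne_zero hs
  have := card_tails_univ_even (j := s) (by omega)
  rw [DV_ladder (s := s + 1) (t := 0) hn a x hx, if_pos rfl]
  push_cast
  rw [this]

theorem DV_P2_boxProd_Pn_even :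
    (∀ v : Fin 2 × Fin 2, DV (pathGraph 2 □ pathGraph 2) v = 3) ∧
    (∀ n : ℕ, Even n → 4 ≤ n → n ≠ 6 → ∀ i : ℕ, ∀ _h1 : 1 ≤ i, ∀ _h2 : i ≤ n,
      ((Odd i → i ≤ n - 3 →
        DV (pathGraph 2 □ pathGraph n) ((0 : Fin 2), (⟨i - 1, by omega⟩ : Fin n)) = n + 2 - i ∧
        DV (pathGraph 2 □ pathGraph n) ((1 : Fin 2), (⟨i - 1, by omega⟩ : Fin n)) = n + 2 - i) ∧
      ((i = 2 ∨ i = n - 1) →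
        DV (pathGraph 2 □ pathGraph n) ((0 : Fin 2), (⟨i - 1, by omega⟩ : Fin n)) = 4 ∧
        DV (pathGraph 2 □ pathGraph n) ((1 : Fin 2), (⟨i - 1, by omega⟩ : Fin n)) = 4) ∧
      (Even i → 4 ≤ i →
        DV (pathGraph 2 □ pathGraph n) ((0 : Fin 2), (⟨i - 1, by omega⟩ : Fin n)) = i + 1 ∧
        DV (pathGraph 2 □ pathGraph n) ((1 : Fin 2), (⟨i - 1, by omega⟩ : Fin n)) = i + 1))) := by
  refine ⟨fun ⟨a, x⟩ => ?_, fun n hn h4 h6 i h1 h2 => ⟨fun hi hi' => ?_, fun hi => ?_,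
    fun hi hi' => ?_⟩⟩
  · rw [DV_ladder (s := 0) (t := 0) rfl a x (by omega), if_pos rfl,
      card_tails_zero_of_nonempty _ Finset.univ_nonempty]
    rfl
  · obtain ⟨h, rfl⟩ := hn
    obtain ⟨s, rfl⟩ := hi
    rw [show h + h + 2 - (2 * s + 1) = 2 * (h - s - 1) + 3 by omega]
    constructor <;>
    exact DV_ladder_of_pos (s := s) (by omega) (by omega) _ _ (Or.inl (by dsimp only; omega))
  · obtain ⟨h, rfl⟩ := hn
    constructor <;>
    exact DV_ladder_of_zero (s := h - 1) (by omega) (by omega) (by omega) _ _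
      (by dsimp only; omega)
  · obtain ⟨h, rfl⟩ := hn
    obtain ⟨t, rfl⟩ := hi
    rw [show t + t + 1 = 2 * (t - 1) + 3 by omega]
    constructor <;>
    exact DV_ladder_of_pos (s := h - t) (by omega) (by omega) _ _
      (Or.inr (by dsimp only; omega))
end

section
/- View P_2 □ P_6 as two copies of P_6 with vertices x_1,…,x_6 and y_1,…,y_6 and edges x_i y_i. For 1 ≤ i ≤ 6: DV(x_i) = DV(y_i) = 7 if i = 1 or i = 6, and DV(x_i) = DV(y_i) = 5 if 2 ≤ i ≤ 5. -/
open SimpleGraph Finset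
open scoped Classical

/-- A decidable form of domination in the ladder: `D` meets every closed neighbourhood,
where `u` lies in the closed neighbourhood of `v` when their `ℓ¹` distance is at most one. -/
def ladderDominates (D : Finset (Fin 2 × Fin 6)) : Bool :=
  decide (∀ v : Fin 2 × Fin 6, ∃ u ∈ D,
    Nat.dist u.1.val v.1.val + Nat.dist u.2.val v.2.val ≤ 1)

lemma eq_or_ladder_adj_iff (u v : Fin 2 × Fin 6) :
    (u = v ∨ (pathGraph 2 □ pathGraph 6).Adj u v) ↔
      Nat.dist u.1.val v.1.val + Nat.dist u.2.val v.2.val ≤ 1 := by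
  obtain ⟨a, b⟩ := u
  obtain ⟨c, d⟩ := v
  simp only [boxProd_adj, pathGraph_adj, Prod.mk.injEq, Fin.ext_iff, Nat.dist]
  omega

lemma isDomSet_iff_exists_eq_or_adj {V : Type*} (G : SimpleGraph V) (D : Finset V) :
    isDomSet G D ↔ ∀ v, ∃ u ∈ D, u = v ∨ G.Adj u v := by
  refine forall_congr' fun v => ⟨fun h => ?_, fun ⟨u, hu, huv⟩ hv => ?_⟩
  · by_cases hv : v ∈ D
    · exact ⟨v, hv, Or.inl rfl⟩
    · obtain ⟨u, hu, huv⟩ := h hv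
      exact ⟨u, hu, Or.inr huv⟩
  · rcases huv with rfl | huv
    · exact absurd hu hv
    · exact ⟨u, hu, huv⟩

lemma isDomSet_ladder_iff_s14 (D : Finset (Fin 2 × Fin 6)) :
    isDomSet (pathGraph 2 □ pathGraph 6) D ↔ ladderDominates D = true := by
  simp only [isDomSet_iff_exists_eq_or_adj, eq_or_ladder_adj_iff, ladderDominates,
    decide_eq_true_eq]

lemma card_ladderDominates_of_lt_four :
    ∀ k : Fin 4,
      #{D ∈ powersetCard k.val (univ : Finset (Fin 2 × Fin 6)) | ladderDominates D = true} = 0 := by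
  decide +kernel

lemma domNum_ladder : domNum (pathGraph 2 □ pathGraph 6) = 4 := by
  refine IsLeast.csInf_eq ⟨⟨{(0, 0), (1, 2), (0, 4), (1, 5)}, ?_, by decide⟩, ?_⟩
  · rw [isDomSet_ladder_iff_s14]
    decide +kernel
  · rintro n ⟨D, hD, rfl⟩
    by_contra! h
    have h0 := card_eq_zero.1 (card_ladderDominates_of_lt_four ⟨#D, h⟩)
    exact filter_eq_empty_iff.1 h0 (mem_powersetCard.2 ⟨subset_univ D, rfl⟩)
      ((isDomSet_ladder_iff_s14 D).1 hD)

lemma DV_ladder_s14 (v : Fin 2 × Fin 6) :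
    DV (pathGraph 2 □ pathGraph 6) v =
      #{D ∈ powersetCard 4 univ | (ladderDominates D && decide (v ∈ D)) = true} := by
  unfold DV gammaSets
  congr 1
  ext D
  simp only [mem_filter, mem_univ, true_and, mem_powersetCard, subset_univ, domNum_ladder,
    isDomSet_ladder_iff_s14, Bool.and_eq_true, decide_eq_true_eq]
  tauto

lemma card_ladder_dominating_sets :
    ∀ (a : Fin 2) (j : Fin 6),
      #{D ∈ powersetCard 4 univ | (ladderDominates D && decide ((a, j) ∈ D)) = true} =
        if j = 0 ∨ j = 5 then 7 else 5 := by
  decide +kernel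

theorem DV_P2_boxProd_P6 (i : ℕ) (h1 : 1 ≤ i) (h2 : i ≤ 6) :
    DV (pathGraph 2 □ pathGraph 6) ((0 : Fin 2), (⟨i - 1, by omega⟩ : Fin 6)) =
      (if i = 1 ∨ i = 6 then 7 else 5) ∧
    DV (pathGraph 2 □ pathGraph 6) ((1 : Fin 2), (⟨i - 1, by omega⟩ : Fin 6)) =
      (if i = 1 ∨ i = 6 then 7 else 5) := by
  simp only [DV_ladder_s14, card_ladder_dominating_sets, Fin.ext_iff]
  interval_cases i <;> simp
end

section
/- For n ≥ 3, the domination number of the Cartesian product P_2 □ C_n satisfies γ(P_2 □ C_n) = n/2 if n ≡ 0 (mod 4), and γ(P_2 □ C_n) = ⌈(n+1)/2⌉ if n ≢ 0 (mod 4). -/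
open SimpleGraph Finset
open scoped Classical

/-- Adjacency in the prism over a cycle, in terms of the group structure on the vertices. -/
theorem prism_adj_iff {m : ℕ} {u v : Fin 2 × Fin (m + 3)} :
    (pathGraph 2 □ cycleGraph (m + 3)).Adj u v ↔
      u = v + (1, 0) ∨ u = v + (0, 1) ∨ u = v - (0, 1) := by
  obtain ⟨a, i⟩ := u
  obtain ⟨b, j⟩ := v
  have hsub (i j : Fin (m + 3)) : i - j = 1 ↔ i = j + 1 := by
    rw [sub_eq_iff_eq_add, add_comm (1 : Fin (m + 3)) j]
  have hsub' (i j : Fin (m + 3)) : j = i + 1 ↔ i = j - 1 := by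
    rw [eq_sub_iff_add_eq, eq_comm]
  have hfin (a b : Fin 2) : a ≠ b ↔ a = b + 1 := by revert a b; decide
  simp only [boxProd_adj, pathGraph_two_eq_top, top_adj, cycleGraph_adj, Prod.mk_add_mk,
    Prod.mk_sub_mk, Prod.mk.injEq, add_zero, sub_zero, hsub, hfin]
  rw [hsub' i j]
  tauto

/-- Consecutive columns of the cycle are adjacent, as are the last and the first. -/
theorem cycleGraph_adj_of_val {m : ℕ} {i j : Fin (m + 3)}
    (h : i.val + 1 = j.val ∨ j.val + 1 = i.val ∨ (i.val = 0 ∧ j.val = m + 2)) :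
    (cycleGraph (m + 3)).Adj i j := by
  rw [cycleGraph_adj']
  have hi := i.isLt
  have hj := j.isLt
  rcases h with h | h | h
  · right
    rw [Fin.sub_val_of_le (by rw [Fin.le_def]; omega)]
    omega
  · left
    rw [Fin.sub_val_of_le (by rw [Fin.le_def]; omega)]
    omega
  · left
    rw [Fin.val_sub, h.1, h.2, Nat.mod_eq_of_lt] <;> omega

/-- The sum over all vertices of the number of dominators is `4 * #D`. -/
theorem sum_dominators_prism {m : ℕ} (f : Fin 2 × Fin (m + 3) → ℕ) :
    ∑ v, (f v + f (v + (1, 0)) + f (v + (0, 1)) + f (v - (0, 1))) = 4 * ∑ v, f v := by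
  have h (c : Fin 2 × Fin (m + 3)) : ∑ v, f (v + c) = ∑ v, f v :=
    Equiv.sum_comp (Equiv.addRight c) f
  simp only [sub_eq_add_neg, Finset.sum_add_distrib, h]
  ring

theorem one_le_dominators_of_isDomSet {m : ℕ} {D : Finset (Fin 2 × Fin (m + 3))}
    (hD : isDomSet (pathGraph 2 □ cycleGraph (m + 3)) D) (v : Fin 2 × Fin (m + 3)) :
    1 ≤ (if v ∈ D then 1 else 0) + (if v + (1, 0) ∈ D then 1 else 0) +
      (if v + (0, 1) ∈ D then 1 else 0) + (if v - (0, 1) ∈ D then 1 else 0) := by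
  by_cases hv : v ∈ D
  · simp only [hv, if_true]
    omega
  · obtain ⟨u, hu, huv⟩ := hD v hv
    rcases prism_adj_iff.1 huv with rfl | rfl | rfl <;> simp only [hu, if_true] <;> omega

theorem le_two_mul_card_of_isDomSet {m : ℕ} {D : Finset (Fin 2 × Fin (m + 3))}
    (hD : isDomSet (pathGraph 2 □ cycleGraph (m + 3)) D) : m + 3 ≤ 2 * D.card := by
  have h := Finset.sum_le_sum fun v (_ : v ∈ Finset.univ) => one_le_dominators_of_isDomSet hD v
  rw [sum_dominators_prism (fun v => if v ∈ D then 1 else 0)] at h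
  simp only [Finset.sum_boole, Finset.sum_const, Finset.card_univ, Fintype.card_prod,
    Fintype.card_fin, Finset.filter_univ_mem, smul_eq_mul, Nat.cast_id] at h
  omega

/-- A dominating set of `n / 2` vertices is a perfect code, which forces `4 ∣ n`. -/
theorem two_mul_card_ne_of_isDomSet {m : ℕ} {D : Finset (Fin 2 × Fin (m + 3))}
    (hD : isDomSet (pathGraph 2 □ cycleGraph (m + 3)) D) (hm : (m + 3) % 4 ≠ 0) :
    2 * D.card ≠ m + 3 := by
  intro hcard
  have hexact (v : Fin 2 × Fin (m + 3)) :
      1 = (if v ∈ D then 1 else 0) + (if v + (1, 0) ∈ D then 1 else 0) +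
        (if v + (0, 1) ∈ D then 1 else 0) + (if v - (0, 1) ∈ D then 1 else 0) := by
    refine (Finset.sum_eq_sum_iff_of_le
      (fun v _ => one_le_dominators_of_isDomSet hD v)).1 ?_ v (Finset.mem_univ v)
    rw [sum_dominators_prism (fun v => if v ∈ D then 1 else 0)]
    simp only [Finset.sum_boole, Finset.sum_const, Finset.card_univ, Fintype.card_prod,
      Fintype.card_fin, Finset.filter_univ_mem, smul_eq_mul, Nat.cast_id]
    omega
  have hvert {v : Fin 2 × Fin (m + 3)} (hv : v ∈ D) : v + (1, 0) ∉ D := by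
    intro h
    have := hexact v
    simp only [hv, h, if_true] at this
    omega
  have hflip (a : Fin 2) : a + 1 + 1 = a := by revert a; decide
  have hstep {v : Fin 2 × Fin (m + 3)} (hv : v ∈ D) : v + (1, 1 + 1) ∈ D := by
    obtain ⟨a, i⟩ := v
    have h0 := hexact (a, i)
    have h1 := hexact (a, i + 1)
    have h2 := hexact (a + 1, i + 1)
    have e : i + 1 + 1 = i + (1 + 1) := add_assoc i 1 1
    simp only [Prod.mk_add_mk, Prod.mk_sub_mk, add_zero, sub_zero, add_sub_cancel_right,
      hflip, e] at h0 h1 h2 ⊢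
    simp only [hv, if_true] at h0 h1
    by_contra hcon
    simp only [hcon, if_false] at h2
    omega
  obtain ⟨v, hv⟩ : D.Nonempty := by
    rw [← Finset.card_pos]
    omega
  have hiter (k : ℕ) : v + k • ((1, 1 + 1) : Fin 2 × Fin (m + 3)) ∈ D := by
    induction k with
    | zero => simpa using hv
    | succ k ih =>
      rw [succ_nsmul, ← add_assoc]
      exact hstep ih
  refine hvert hv ?_
  convert hiter D.card using 2
  ext1
  · have h : D.card = 2 * (D.card / 2) + 1 := by omega
    have h2 : (2 : ℕ) • (1 : Fin 2) = 0 := by decide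
    rw [Prod.smul_fst, h, add_nsmul, mul_comm, mul_nsmul', h2]
    simp
  · have h : (m + 3) • (1 : Fin (m + 3)) = 0 := by
      simpa using card_nsmul_eq_zero (x := (1 : Fin (m + 3)))
    rw [Prod.smul_snd, nsmul_add, ← add_nsmul, ← two_mul, hcard, h]

theorem exists_isDomSet_prism_card_le (m : ℕ) :
    ∃ D : Finset (Fin 2 × Fin (m + 3)), isDomSet (pathGraph 2 □ cycleGraph (m + 3)) D ∧
      D.card ≤ if (m + 3) % 4 = 0 then (m + 3) / 2 else (m + 3 + 2) / 2 := by
  set N := if (m + 3) % 4 = 0 then (m + 3) / 2 else (m + 3 + 2) / 2 with hN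
  let p (j : ℕ) : Fin 2 × Fin (m + 3) :=
    (⟨j % 2, Nat.mod_lt _ two_pos⟩, ⟨min (2 * j) (m + 2), by omega⟩)
  refine ⟨(Finset.range N).image p, ?_, Finset.card_image_le.trans (Finset.card_range N).le⟩
  rintro ⟨a, i⟩ hv
  suffices h : ∃ j < N, (p j).2 = i ∨ (p j).1 = a ∧ (cycleGraph (m + 3)).Adj (p j).2 i by
    obtain ⟨j, hj, h⟩ := h
    have hmem : p j ∈ (Finset.range N).image p :=
      Finset.mem_image_of_mem p (Finset.mem_range.2 hj)
    refine ⟨p j, hmem, ?_⟩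
    rw [boxProd_adj, pathGraph_two_eq_top, top_adj]
    rcases h with h | ⟨h1, h2⟩
    · refine Or.inl ⟨fun h1 => hv ?_, h⟩
      rwa [← show p j = (a, i) from Prod.ext h1 h]
    · exact Or.inr ⟨h2, h1⟩
  have hi := i.isLt
  have ha := a.isLt
  have hcol (j : ℕ) : ((p j).2 : ℕ) = min (2 * j) (m + 2) := rfl
  have hrow (j : ℕ) : ((p j).1 : ℕ) = j % 2 := rfl
  rcases Nat.even_or_odd' (i : ℕ) with ⟨j, hj | hj⟩
  · refine ⟨j, by grind, Or.inl (Fin.ext ?_)⟩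
    rw [hcol]
    omega
  by_cases hja : j % 2 = a
  · refine ⟨j, by grind, Or.inr ⟨Fin.ext (by rw [hrow, hja]), cycleGraph_adj_of_val ?_⟩⟩
    rw [hcol]
    omega
  by_cases hlast : (i : ℕ) = m + 2
  · by_cases hm : (m + 3) % 4 = 0
    · refine ⟨0, by grind, Or.inr ⟨Fin.ext (by rw [hrow]; omega), cycleGraph_adj_of_val ?_⟩⟩
      rw [hcol]
      omega
    · refine ⟨j + 1, by grind, Or.inl (Fin.ext ?_)⟩
      rw [hcol]
      omega
  · refine ⟨j + 1, by grind, Or.inr ⟨Fin.ext (by rw [hrow]; omega), cycleGraph_adj_of_val ?_⟩⟩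
    rw [hcol]
    omega

theorem domNum_P2_boxProd_Cn (n : ℕ) (hn : 3 ≤ n) :
    domNum (pathGraph 2 □ cycleGraph n) =
      if n % 4 = 0 then n / 2 else (n + 2) / 2 := by
  obtain ⟨m, rfl⟩ := Nat.exists_eq_add_of_le' hn
  obtain ⟨D, hD, hcard⟩ := exists_isDomSet_prism_card_le m
  have hle : domNum (pathGraph 2 □ cycleGraph (m + 3)) ≤ D.card := Nat.sInf_le ⟨D, hD, rfl⟩
  refine le_antisymm (hle.trans hcard) (le_csInf ⟨D.card, D, hD, rfl⟩ ?_)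
  rintro _ ⟨E, hE, rfl⟩
  have h1 := le_two_mul_card_of_isDomSet hE
  have h2 := two_mul_card_ne_of_isDomSet hE
  split_ifs with h
  · omega
  · have := h2 h
    omega
end
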